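/- arXiv:2203.00704 — 2 statements merged into one kernel-verified Lean document; each statement's English description precedes it below -/
import Mathlib

section
/- Let d be a nonzero integer with d ≡ 0 or 1 mod 4 a fundamental discriminant, and let n be an integer. The Gauss sum G(n,d) = Σ_{c mod |d|} χ_d(c) e(nc/|d|) satisfies G(n,d) = χ_d(n)·√|d| if d > 0 and G(n,d) = χ_d(n)·i·√|d| if d < 0, where χ_d(c) = (d/c) is the Kronecker symbol and e(x) = e^{2πix}. -/
open Complex

/-- The Kronecker symbol `(d/n)`. -/
def kronecker (d n : ℤ) : ℤ :=
  if n = 0 then (if d = 1 ∨ d = -1 then 1 else 0)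
  else
    (if n < 0 ∧ d < 0 then -1 else 1) *
    (if d % 2 = 0 then (if n.natAbs.factorization 2 = 0 then 1 else 0)
      else (if d % 8 = 1 ∨ d % 8 = 7 then 1 else -1) ^ (n.natAbs.factorization 2)) *
    jacobiSym d (n.natAbs / 2 ^ (n.natAbs.factorization 2))

/-- `d` is a fundamental discriminant. -/
def IsFundamentalDiscriminant (d : ℤ) : Prop :=
  (d % 4 = 1 ∧ Squarefree d) ∨
    (d % 4 = 0 ∧ Squarefree (d / 4) ∧ ((d / 4) % 4 = 2 ∨ (d / 4) % 4 = 3))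

/-- `e(x) = exp(2πix)`. -/
noncomputable def eexp (x : ℂ) : ℂ := Complex.exp (2 * Real.pi * Complex.I * x)


open Filter Topology in
lemma aux_theta_tendsto (x : ℝ) :
    Tendsto (fun τ : ℂ => jacobiTheta₂ x τ) (comap im atTop) (𝓝 1) := by
  have key : ∀ τ : ℂ, 0 < τ.im → ‖jacobiTheta₂ x τ - 1‖ ≤ ‖jacobiTheta (I * τ.im) - 1‖ := by
    intro τ hτ
    have hτ' : 0 < (I * (τ.im : ℂ)).im := by simpa using hτ
    have h1 := hasSum_jacobiTheta₂_term (x : ℂ) hτ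
    have h2 := hasSum_jacobiTheta₂_term 0 hτ'
    rw [← jacobiTheta_eq_jacobiTheta₂] at h2
    have hs : HasSum (fun n : ℤ => if n = 0 then (1 : ℂ) else 0) 1 := hasSum_ite_eq 0 1
    have h1' := h1.sub hs
    have h2' := h2.sub hs
    set g : ℤ → ℝ := fun n => if n = 0 then 0 else Real.exp (-Real.pi * n ^ 2 * τ.im) with hg
    have e2 : ∀ n : ℤ, jacobiTheta₂_term n 0 (I * τ.im) - (if n = 0 then (1 : ℂ) else 0) = (g n : ℂ) := by
      intro n
      by_cases hn : n = 0
      · simp [hn, jacobiTheta₂_term, hg]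
      · simp only [hn, hg, jacobiTheta₂_term, if_false, sub_zero]
        push_cast
        congr 1
        linear_combination (Real.pi * n^2 * τ.im : ℂ) * I_mul_I
    simp_rw [e2] at h2'
    have e1 : ∀ n : ℤ, ‖jacobiTheta₂_term n x τ - (if n = 0 then (1 : ℂ) else 0)‖ = g n := by
      intro n
      by_cases hn : n = 0
      · simp [hn, jacobiTheta₂_term, hg]
      · simp only [hn, hg, if_false, sub_zero]
        rw [norm_jacobiTheta₂_term]
        simp
    have h3 : Summable g := by
      exact_mod_cast h2'.summable
    have h4 : jacobiTheta (I * τ.im) - 1 = ((∑' n, g n : ℝ) : ℂ) := by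
      rw [← h2'.tsum_eq]; push_cast; rfl
    rw [h4, ← h1'.tsum_eq]
    refine (norm_tsum_le_tsum_norm ?_).trans ?_
    · simp_rw [e1]; exact h3
    · simp_rw [e1]; rw [Complex.norm_real]; exact le_abs_self _
  have h5 : Tendsto (fun τ : ℂ => ‖jacobiTheta (I * τ.im) - 1‖) (comap im atTop) (𝓝 0) := by
    have h6 : Tendsto (fun τ : ℂ => I * (τ.im : ℂ)) (comap im atTop) (comap im atTop) := by
      rw [tendsto_comap_iff]
      refine tendsto_comap.congr ?_
      intro τ; simp
    have h7 := (isBigO_at_im_infty_jacobiTheta_sub_one.comp_tendsto h6).trans_tendsto (g'' := fun τ : ℂ => Real.exp (-Real.pi * (I * (τ.im : ℂ)).im)) ?_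
    · simpa using h7.norm
    · have : Tendsto (fun y : ℝ => Real.exp (-Real.pi * y)) atTop (𝓝 0) :=
        Real.tendsto_exp_atBot.comp (tendsto_id.const_mul_atTop_of_neg (by simpa using Real.pi_pos))
      refine (this.comp tendsto_comap).congr ?_
      intro τ; simp
  rw [tendsto_iff_norm_sub_tendsto_zero]
  refine squeeze_zero' (Eventually.of_forall fun _ => norm_nonneg _) ?_ h5
  have : ∀ᶠ τ : ℂ in comap im atTop, 0 < τ.im := tendsto_comap.eventually (eventually_gt_atTop 0)
  filter_upwards [this] with τ hτ using key τ hτ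

lemma aux_theta_per (M : ℕ) [NeZero M] (a : ℂ) (ha : a.im = 0)
    (hf : ∀ k n : ℤ, cexp (Real.pi * I * (k * M + n) ^ 2 * a) = cexp (Real.pi * I * n ^ 2 * a))
    (δ : ℂ) (hδ : 0 < δ.re) :
    jacobiTheta₂ 0 (a + I * δ) = 1 / (δ * M ^ 2) ^ (1 / 2 : ℂ) *
      ∑ r : Fin M, cexp (Real.pi * I * (r : ℂ) ^ 2 * a) *
        jacobiTheta₂ ((r : ℝ) / M : ℝ) (I / (δ * M ^ 2)) := by
  have hM : (M : ℂ) ≠ 0 := by exact_mod_cast NeZero.ne M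
  have hMr : (0:ℝ) < M := by exact_mod_cast NeZero.pos M
  have hδ0 : δ ≠ 0 := by rintro rfl; simp at hδ
  have him : 0 < (a + I * δ).im := by simpa [ha] using hδ
  have h0 := hasSum_jacobiTheta₂_term 0 him
  have h1 := ((Int.divModEquiv M).symm.hasSum_iff).2 h0
  have h2 : Summable _ := h1.summable
  have h3 := ((Equiv.prodComm _ _).hasSum_iff).2 h1
  rw [← h3.tsum_eq, h3.summable.tsum_prod' , tsum_fintype, Finset.mul_sum]
  · refine Finset.sum_congr rfl fun r _ => ?_
    have fe := jacobiTheta₂_functional_equation (I * δ * M * r) (I * δ * M ^ 2)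
    have e1 : -I * (I * δ * M ^ 2) = δ * M ^ 2 := by
      linear_combination (-δ * M ^ 2) * I_mul_I
    have e2 : (I * δ * M * r) / (I * δ * M ^ 2) = (((r : ℝ) / M : ℝ) : ℂ) := by
      push_cast
      field_simp
    have e3 : -1 / (I * δ * M ^ 2) = I / (δ * M ^ 2) := by
      field_simp; simp
    have e4 : -Real.pi * I * (I * δ * M * r) ^ 2 / (I * δ * M ^ 2) = Real.pi * δ * (r : ℂ)^2 := by
      field_simp; simp
    rw [e1, e2, e3, e4] at fe
    have : ∀ k : ℤ, (((fun n => jacobiTheta₂_term n 0 (a + I * δ)) ∘ ⇑(Int.divModEquiv M).symm) ∘ ⇑(Equiv.prodComm (Fin M) ℤ)) (r, k) = cexp (Real.pi * I * (r : ℂ) ^ 2 * a) * cexp (- (Real.pi * δ * (r : ℂ)^2)) * jacobiTheta₂_term k (I * δ * M * r) (I * δ * M ^ 2) := by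
      intro k
      have hk := hf k r
      simp only [Function.comp, Equiv.prodComm_apply, Prod.swap, Int.divModEquiv_symm_apply, jacobiTheta₂_term]
      push_cast at hk ⊢
      rw [← hk, ← Complex.exp_add, ← Complex.exp_add]
      congr 1
      linear_combination (Real.pi * (r : ℂ)^2 * δ ) * I_mul_I
    simp_rw [this]
    rw [tsum_mul_left, ← jacobiTheta₂, fe, Complex.exp_neg]
    have := Complex.exp_ne_zero (Real.pi * δ * (r : ℂ)^2)
    field_simp
  · intro r
    exact h3.summable.prod_factor r

lemma aux_cpow_half (x : ℂ) (y : ℂ) (hxy : y ^ 2 = x) (hy : 0 < y.re) :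
    x ^ (1 / 2 : ℂ) = y := by
  rw [← hxy]
  have := Complex.pow_cpow_nat_inv (x := y) (n := 2) (by norm_num)
  have harg := Complex.abs_arg_lt_pi_div_two_iff.2 (Or.inl hy)
  rw [abs_lt] at harg
  have h2 := this (by push_cast; linarith) (by push_cast; linarith)
  rw [one_div]
  exact_mod_cast h2

open Filter Topology in
lemma aux_quad_gauss (N : ℕ) [NeZero N] :
    ∑ r : Fin N, cexp (Real.pi * I * (r : ℂ) ^ 2 * (2 / N)) =
      Real.sqrt N * (1 + I) / 2 * (1 + (-I) ^ N) := by
  have hN : (N : ℂ) ≠ 0 := by exact_mod_cast NeZero.ne N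
  have hNr : (0:ℝ) < N := by exact_mod_cast NeZero.pos N
  have hNim : (2 / (N:ℂ)).im = 0 := by
    rw [show (2 / (N:ℂ)) = ((2 / (N:ℝ) : ℝ) : ℂ) by push_cast; rfl]; exact ofReal_im _
  have hNim' : (-(N:ℂ) / 2).im = 0 := by
    rw [show (-(N:ℂ) / 2) = ((-(N:ℝ) / 2 : ℝ) : ℂ) by push_cast; rfl]; exact ofReal_im _
  have hNre : (2 / (N:ℂ)).re = 2 / N := by
    rw [show (2 / (N:ℂ)) = ((2 / (N:ℝ) : ℝ) : ℂ) by push_cast; rfl]; exact ofReal_re _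
  have per1 : ∀ k n : ℤ, cexp (Real.pi * I * (k * N + n) ^ 2 * (2 / N)) = cexp (Real.pi * I * n ^ 2 * (2 / N)) := by
    intro k n
    rw [Complex.exp_eq_exp_iff_exists_int]
    refine ⟨k ^ 2 * N + 2 * k * n, ?_⟩
    push_cast
    field_simp
    ring
  have per2 : ∀ k n : ℤ, cexp (Real.pi * I * (k * (2 : ℕ) + n) ^ 2 * (-(N:ℂ) / 2)) = cexp (Real.pi * I * n ^ 2 * (-(N:ℂ) / 2)) := by
    intro k n
    rw [Complex.exp_eq_exp_iff_exists_int]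
    refine ⟨-(k ^ 2 + k * n) * N, ?_⟩
    push_cast
    ring
  set A : ℝ → ℂ := fun ε => ∑ r : Fin N, cexp (Real.pi * I * (r : ℂ) ^ 2 * (2 / N)) *
        jacobiTheta₂ ((r : ℝ) / N : ℝ) (I / (ε * N ^ 2)) with hA
  set B : ℝ → ℂ := fun ε => ∑ r : Fin 2, cexp (Real.pi * I * (r : ℂ) ^ 2 * (-(N:ℂ) / 2)) *
        jacobiTheta₂ ((r : ℝ) / (2 : ℕ) : ℝ) (I * (2 / N + I * ε) / (2 * N * ε)) with hB
  have key : ∀ ε : ℝ, 0 < ε → 1 / ((N:ℂ) ^ 2) ^ (1 / 2 : ℂ) * A ε =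
      1 / (-I * (2 / N + I * ε)) ^ (1 / 2 : ℂ) * (1 / (2 * N / (2 / N + I * ε)) ^ (1 / 2 : ℂ) * B ε) := by
    intro ε hε
    have hεc : (ε : ℂ) ≠ 0 := by exact_mod_cast hε.ne'
    set τ : ℂ := 2 / N + I * ε with hτ
    have hτre : 0 < τ.re := by
      rw [hτ, add_re, hNre]; simp [NeZero.pos N]
    have hτ0 : τ ≠ 0 := by intro h; rw [h] at hτre; simp at hτre
    have t1 := aux_theta_per N (2 / N) hNim per1 ε (by simpa using hε)
    have hδ : 0 < (N * ε / (2 * τ) : ℂ).re := by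
      rw [show (N * ε / (2 * τ) : ℂ) = ((N * ε / 2 : ℝ) : ℂ) * τ⁻¹ by push_cast; field_simp,
        Complex.re_ofReal_mul, Complex.inv_re]
      have := Complex.normSq_pos.2 hτ0
      positivity
    have t2 := aux_theta_per 2 (-N / 2) hNim' per2 (N * ε / (2 * τ)) hδ
    have fe := jacobiTheta₂_functional_equation 0 τ
    have e1 : -1 / τ = -N / 2 + I * (N * ε / (2 * τ)) := by
      have h2 : (N:ℂ) * τ = 2 + N * I * ε := by rw [hτ]; field_simp
      field_simp
      linear_combination h2
    have e2 : (N * ε / (2 * τ)) * ((2 : ℕ) : ℂ) ^ 2 = ε * (2 * N / τ) := by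
      push_cast; field_simp
    have e3 : I / (ε * (2 * N / τ)) = I * τ / (2 * N * ε) := by
      field_simp
    have sp : ∀ w : ℂ, (ε * w) ^ (1 / 2 : ℂ) = (ε : ℂ) ^ (1 / 2 : ℂ) * w ^ (1 / 2 : ℂ) := by
      intro w
      by_cases hw : w = 0
      · simp [hw]
      · rw [Complex.cpow_def_of_ne_zero (mul_ne_zero hεc hw), Complex.cpow_def_of_ne_zero hεc, Complex.cpow_def_of_ne_zero hw, Complex.log_ofReal_mul hε hw, Complex.ofReal_log hε.le, ← Complex.exp_add, add_mul]
    rw [e2, e3, sp] at t2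
    rw [sp] at t1
    rw [← hτ] at t1
    rw [zero_div, e1, t2, t1] at fe
    have hs : (ε : ℂ) ^ (1 / 2 : ℂ) ≠ 0 := by simp [hεc]
    have := congrArg (fun x => (ε : ℂ) ^ (1 / 2 : ℂ) * x) fe
    simp only [zero_pow, ne_eq, OfNat.ofNat_ne_zero, not_false_eq_true, mul_zero, zero_div, Complex.exp_zero, mul_one] at this
    rw [hA, hB]
    simp only
    rw [← hτ]
    convert this using 1
    · field_simp
    · field_simp
  have limA : Tendsto A (𝓝[>] 0) (𝓝 (∑ r : Fin N, cexp (Real.pi * I * (r : ℂ) ^ 2 * (2 / N)) * 1)) := by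
    refine tendsto_finsetSum _ fun r _ => Tendsto.const_mul _ ?_
    refine (aux_theta_tendsto _).comp ?_
    rw [tendsto_comap_iff]
    have : Tendsto (fun ε : ℝ => 1 / (N:ℝ)^2 * ε⁻¹) (𝓝[>] 0) atTop :=
      tendsto_inv_nhdsGT_zero.const_mul_atTop (by positivity)
    refine this.congr fun ε => ?_
    rw [Function.comp, show I / (ε * (N:ℂ)^2) = ((1 / (N:ℝ)^2 * ε⁻¹ : ℝ) : ℂ) * I by push_cast; ring, Complex.im_ofReal_mul, I_im, mul_one]
  have limB : Tendsto B (𝓝[>] 0) (𝓝 (∑ r : Fin 2, cexp (Real.pi * I * (r : ℂ) ^ 2 * (-(N:ℂ) / 2)) * 1)) := by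
    refine tendsto_finsetSum _ fun r _ => Tendsto.const_mul _ ?_
    refine (aux_theta_tendsto _).comp ?_
    rw [tendsto_comap_iff]
    have : Tendsto (fun ε : ℝ => 1 / (N:ℝ)^2 * ε⁻¹) (𝓝[>] 0) atTop :=
      tendsto_inv_nhdsGT_zero.const_mul_atTop (by positivity)
    refine this.congr' ?_
    filter_upwards [self_mem_nhdsWithin] with ε hε
    have hε : 0 < ε := hε
    have hεc : (ε : ℂ) ≠ 0 := by exact_mod_cast hε.ne'
    rw [Function.comp, show I * (2 / N + I * ε) / (2 * N * ε) = ((1 / (N:ℝ)^2 * ε⁻¹ : ℝ) : ℂ) * I + ((-1 / (2 * N) : ℝ) : ℂ) by push_cast; field_simp; linear_combination (N * ε : ℂ) * I_sq, add_im, Complex.im_ofReal_mul, I_im, mul_one, ofReal_im, add_zero]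
  have lim1 : Tendsto (fun ε : ℝ => (2 / N + I * ε : ℂ)) (𝓝[>] 0) (𝓝 (2 / N)) := by
    have : Continuous (fun ε : ℝ => (2 / N + I * ε : ℂ)) := by fun_prop
    have := this.tendsto 0
    simp only [ofReal_zero, mul_zero, add_zero] at this
    exact this.mono_left nhdsWithin_le_nhds
  have h2N : (2 / N : ℂ) ≠ 0 := div_ne_zero two_ne_zero hN
  have lim2 : Tendsto (fun ε : ℝ => (-I * (2 / N + I * ε)) ^ (1 / 2 : ℂ)) (𝓝[>] 0) (𝓝 ((-I * (2 / N)) ^ (1 / 2 : ℂ))) := by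
    refine (lim1.const_mul (-I)).cpow tendsto_const_nhds ?_
    right
    rw [show -I * (2 / (N:ℂ)) = ((2 / N : ℝ) : ℂ) * (-I) by push_cast; ring, Complex.im_ofReal_mul]
    simp [NeZero.ne N]
  have lim3 : Tendsto (fun ε : ℝ => (2 * N / (2 / N + I * ε)) ^ (1 / 2 : ℂ)) (𝓝[>] 0) (𝓝 ((2 * N / (2 / N)) ^ (1 / 2 : ℂ))) := by
    refine ((tendsto_const_nhds (x := (2 * N : ℂ))).div lim1 h2N).cpow tendsto_const_nhds ?_
    left
    rw [show (2 * N / (2 / N : ℂ)) = ((N ^ 2 : ℝ) : ℂ) by push_cast; field_simp, ofReal_re]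
    positivity
  have v3 : (2 * N / (2 / N) : ℂ) ^ (1 / 2 : ℂ) = N := by
    apply aux_cpow_half
    · field_simp
    · simpa using hNr
  have v0 : ((N:ℂ) ^ 2) ^ (1 / 2 : ℂ) = N := by
    apply aux_cpow_half
    · rfl
    · simpa using hNr
  have hsq : (Real.sqrt N : ℂ) ^ 2 = N := by
    rw [← ofReal_pow, Real.sq_sqrt hNr.le]; simp
  have hsp : 0 < Real.sqrt N := Real.sqrt_pos.2 hNr
  have hs0 : (Real.sqrt N : ℂ) ≠ 0 := by exact_mod_cast hsp.ne'
  have v2 : (-I * (2 / N) : ℂ) ^ (1 / 2 : ℂ) = ((Real.sqrt N)⁻¹ : ℝ) * (1 - I) := by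
    have : 0 < ((((Real.sqrt N)⁻¹ : ℝ) : ℂ) * (1 - I)).re := by
      rw [Complex.re_ofReal_mul]; simp [hNr]
    apply aux_cpow_half _ _ _ this
    push_cast
    rw [mul_pow, inv_pow, hsq, show (1 - I) ^ 2 = -2 * I by ring_nf; rw [I_sq]; ring]
    ring
  have hI : (1 - I) ≠ 0 := by
    intro h; have := congrArg Complex.im h; simp at this
  have v2' : (-I * (2 / N) : ℂ) ^ (1 / 2 : ℂ) ≠ 0 := by
    rw [v2]; push_cast; exact mul_ne_zero (inv_ne_zero hs0) hI
  have L1 := limA.const_mul (1 / ((N:ℂ) ^ 2) ^ (1 / 2 : ℂ))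
  have L2 := ((tendsto_const_nhds (x := (1:ℂ))).div lim2 v2').mul (((tendsto_const_nhds (x := (1:ℂ))).div lim3 (by rw [v3]; exact hN)).mul limB)
  have := tendsto_nhds_unique (L1.congr' (by filter_upwards [self_mem_nhdsWithin] with ε hε using key ε hε)) L2
  rw [v0, v3, v2] at this
  simp only [mul_one, Fin.sum_univ_two] at this
  have ev : cexp (Real.pi * I * ((1 : Fin 2) : ℕ) ^ 2 * (-(N:ℂ) / 2)) = (-I) ^ N := by
    rw [show (-I) = cexp (-(Real.pi / 2) * I) by simp [Complex.exp_neg, Complex.exp_pi_div_two_mul_I, neg_mul], ← Complex.exp_nat_mul]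
    congr 1
    simp; ring
  rw [ev] at this
  simp only [Fin.val_zero, Nat.cast_zero, ne_eq, OfNat.ofNat_ne_zero, not_false_eq_true, zero_pow, mul_zero, zero_mul, Complex.exp_zero] at this
  generalize (∑ r : Fin N, cexp (Real.pi * I * (r : ℂ) ^ 2 * (2 / N))) = S at this ⊢
  have h1I : (1 - I) * (1 + I) = 2 := by ring_nf; rw [I_sq]; ring
  push_cast at this
  field_simp at this
  linear_combination (1 + I) / 2 * this - (1/2) * S * h1I

lemma aux_sum_range_zmod (p : ℕ) [NeZero p] (F : ZMod p → ℂ) :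
    ∑ c ∈ Finset.range p, F (c : ZMod p) = ∑ x : ZMod p, F x := by
  refine Finset.sum_nbij' (fun c => (c : ZMod p)) ZMod.val ?_ ?_ ?_ ?_ ?_
  · intros; simp
  · intro x _; simpa using ZMod.val_lt x
  · intro c hc; exact ZMod.val_cast_of_lt (by simpa using hc)
  · intro x _; simp
  · intros; rfl

lemma aux_prime_gauss (p : ℕ) [Fact p.Prime] (hp2 : p ≠ 2) (n : ℤ) :
    ∑ c ∈ Finset.range p, (legendreSym p c : ℂ) * eexp (n * c / p) =
      legendreSym p n * Real.sqrt p * (if p % 4 = 1 then 1 else I) := by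
  have hp := (Fact.out : p.Prime)
  have hchar : ringChar (ZMod p) ≠ 2 := by rwa [ZMod.ringChar_zmod_n]
  set χ : MulChar (ZMod p) ℂ := (quadraticChar (ZMod p)).ringHomComp (Int.castRingHom ℂ) with hχ
  have hχa : ∀ a, χ a = (quadraticChar (ZMod p) a : ℂ) := fun a => rfl
  set ψ : AddChar (ZMod p) ℂ := ZMod.stdAddChar with hψ
  have hψ1 : ψ ≠ 1 := by
    intro h
    have := ZMod.isPrimitive_stdAddChar p (one_ne_zero)
    apply this
    rw [AddChar.mulShift_one]; exact h
  have e1 : ∀ c : ℕ, (legendreSym p c : ℂ) * eexp (n * c / p) = χ (c : ZMod p) * ψ ((n : ZMod p) * (c : ZMod p)) := by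
    intro c
    have := ZMod.stdAddChar_coe (N := p) (n * c)
    push_cast at this
    rw [hχa, hψ, this, legendreSym, eexp]
    congr 2
    · simp
    · ring
  simp_rw [e1]
  rw [aux_sum_range_zmod p (fun x => χ x * ψ (n * x))]
  have G1 : ∑ x, χ x * ψ x = Real.sqrt p * (if p % 4 = 1 then 1 else I) := by
    have h0 : ∑ x, ψ x = 0 := AddChar.sum_eq_zero_of_ne_one hψ1
    have h1 : ∑ x, χ x * ψ x = ∑ x : ZMod p, ψ (x ^ 2) := by
      rw [← Finset.sum_fiberwise Finset.univ (fun x : ZMod p => x ^ 2) (fun x => ψ (x ^ 2)), ← add_zero (∑ x, χ x * ψ x), ← h0, ← Finset.sum_add_distrib]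
      refine Finset.sum_congr rfl fun a _ => ?_
      have h2 := quadraticChar_card_sqrts hchar a
      have h3 : ∑ x ∈ Finset.univ.filter (fun x : ZMod p => x ^ 2 = a), ψ (x ^ 2) =
          ∑ x ∈ Finset.univ.filter (fun x : ZMod p => x ^ 2 = a), ψ a :=
        Finset.sum_congr rfl fun x hx => by rw [(Finset.mem_filter.1 hx).2]
      rw [h3, Finset.sum_const, nsmul_eq_mul, hχa]
      have h4 : ((Finset.univ.filter (fun x : ZMod p => x ^ 2 = a)).card : ℤ) = quadraticChar (ZMod p) a + 1 := by
        rw [← h2]; congr 2; ext x; simp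
      have h5 := congrArg (Int.cast : ℤ → ℂ) h4
      push_cast at h5
      rw [h5]; ring
    rw [h1, ← aux_sum_range_zmod p (fun x => ψ (x ^ 2)), Finset.sum_range]
    have h6 := aux_quad_gauss p
    have h7 : ∀ r : Fin p, ψ (((r : ℕ) : ZMod p) ^ 2) = cexp (Real.pi * I * (r : ℂ) ^ 2 * (2 / p)) := by
      intro r
      have := ZMod.stdAddChar_coe (N := p) ((r : ℕ) ^ 2)
      push_cast at this
      rw [hψ, this]
      congr 1
      ring
    simp_rw [h7]
    rw [h6]
    have hodd := hp.eq_two_or_odd.resolve_left hp2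
    have hI4 : (-I) ^ p = (-I) ^ (p % 4) := by
      conv_lhs => rw [← Nat.div_add_mod p 4, pow_add, pow_mul]
      rw [Even.neg_pow (by decide), I_pow_four, one_pow, one_mul]
    rw [hI4]
    rcases (by omega : p % 4 = 1 ∨ p % 4 = 3) with h | h
    · rw [h]; simp only [if_true]
      linear_combination (-(Real.sqrt p : ℂ) / 2) * I_sq
    · rw [h]; simp only [show ¬ (3 = 1) by norm_num, if_false]
      linear_combination (Real.sqrt p : ℂ) / 2 * (1 - I ^ 2 - I) * I_sq
  by_cases hn : (n : ZMod p) = 0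
  · have : legendreSym p n = 0 := (legendreSym.eq_zero_iff p n).2 hn
    rw [this]
    simp only [hn, zero_mul, AddChar.map_zero_eq_one, mul_one, Int.cast_zero, hχa]
    exact_mod_cast quadraticChar_sum_zero hchar
  · have h8 := gaussSum_mulShift χ ψ (Units.mk0 _ hn)
    simp only [gaussSum, Units.val_mk0, AddChar.mulShift_apply] at h8
    have h9 : (legendreSym p n : ℂ) * χ n = 1 := by
      rw [hχa, legendreSym, ← Int.cast_mul, ← sq, quadraticChar_sq_one hn, Int.cast_one]
    rw [mul_assoc, ← G1, ← h8, ← mul_assoc, h9, one_mul]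

lemma aux_kron_mul_left (d₁ d₂ n : ℤ) (h₁ : d₁ ≠ 0) (h₂ : d₂ ≠ 0) :
    kronecker (d₁ * d₂) n = kronecker d₁ n * kronecker d₂ n := by
  unfold kronecker
  by_cases hn : n = 0
  · simp only [hn, if_true]
    have : (d₁ * d₂ = 1 ∨ d₁ * d₂ = -1) ↔ (d₁ = 1 ∨ d₁ = -1) ∧ (d₂ = 1 ∨ d₂ = -1) := by
      rw [← Int.isUnit_iff, ← Int.isUnit_iff, ← Int.isUnit_iff, IsUnit.mul_iff]
    simp only [this]
    split_ifs <;> simp_all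
  · simp only [hn, if_false]
    rw [jacobiSym.mul_left]
    have s : (if n < 0 ∧ d₁ * d₂ < 0 then (-1:ℤ) else 1) = (if n < 0 ∧ d₁ < 0 then -1 else 1) * (if n < 0 ∧ d₂ < 0 then -1 else 1) := by
      by_cases hn : n < 0
      · simp only [hn, true_and]
        rcases lt_or_gt_of_ne h₁ with a | a <;> rcases lt_or_gt_of_ne h₂ with b | b
        · simp [a, b, (mul_pos_of_neg_of_neg a b).le]
        · simp [a, b.le, (mul_neg_of_neg_of_pos a b)]
        · simp [a.le, b, (mul_neg_of_pos_of_neg a b)]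
        · simp [not_lt.2 a.le, not_lt.2 b.le, not_lt.2 (mul_pos a b).le]
      · simp [hn]
    rw [s]
    generalize n.natAbs.factorization 2 = k
    have t : (if d₁ * d₂ % 2 = 0 then (if k = 0 then (1:ℤ) else 0)
      else (if d₁ * d₂ % 8 = 1 ∨ d₁ * d₂ % 8 = 7 then 1 else -1) ^ k) = 
      (if d₁ % 2 = 0 then (if k = 0 then (1:ℤ) else 0)
      else (if d₁ % 8 = 1 ∨ d₁ % 8 = 7 then 1 else -1) ^ k) * 
      (if d₂ % 2 = 0 then (if k = 0 then (1:ℤ) else 0)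
      else (if d₂ % 8 = 1 ∨ d₂ % 8 = 7 then 1 else -1) ^ k) := by
      have m8 := Int.mul_emod d₁ d₂ 8
      have m2 := Int.mul_emod d₁ d₂ 2
      have a1 : d₁ % 2 = d₁ % 8 % 2 := by omega
      have a2 : d₂ % 2 = d₂ % 8 % 2 := by omega
      rw [m8, m2, a1, a2]
      have b1 : 0 ≤ d₁ % 8 ∧ d₁ % 8 < 8 := by omega
      have b2 : 0 ≤ d₂ % 8 ∧ d₂ % 8 < 8 := by omega
      generalize d₁ % 8 = x at *
      generalize d₂ % 8 = y at *
      obtain ⟨b1, b1'⟩ := b1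
      obtain ⟨b2, b2'⟩ := b2
      by_cases hk : k = 0
      · subst hk
        simp
      · clear m8 m2 a1 a2
        simp only [hk, if_false]
        interval_cases x <;> interval_cases y <;> simp [hk, ← mul_pow]
    rw [t]; ring

lemma aux_kron_prime (p : ℕ) [Fact p.Prime] (hp2 : p ≠ 2) (c : ℤ) :
    kronecker (if p % 4 = 1 then (p : ℤ) else -p) c = legendreSym p c := by
  have hp := (Fact.out : p.Prime)
  have hodd := hp.eq_two_or_odd.resolve_left hp2
  have hodd' : Odd p := Nat.odd_iff.2 hodd
  have hp3 : 3 ≤ p := by have := hp.two_le; omega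
  set q : ℤ := if p % 4 = 1 then (p : ℤ) else -p with hq
  have hqcase : (p % 4 = 1 ∧ q = p) ∨ (p % 4 = 3 ∧ q = -p) := by
    rcases (by omega : p % 4 = 1 ∨ p % 4 = 3) with h | h
    · left; exact ⟨h, by simp [hq, h]⟩
    · right; exact ⟨h, by simp [hq, h]⟩
  clear_value q
  unfold kronecker
  by_cases hc : c = 0
  · subst hc
    have : ¬ (q = 1 ∨ q = -1) := by omega
    simp [this]
  · simp only [hc, if_false]
    have hn0 : c.natAbs ≠ 0 := by simpa using hc
    have hprod := Nat.ordProj_mul_ordCompl_eq_self c.natAbs 2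
    have hmo := Nat.not_dvd_ordCompl Nat.prime_two hn0
    generalize c.natAbs.factorization 2 = k at *
    generalize hm : c.natAbs / 2 ^ k = m at *
    have hmodd : Odd m := by rw [← Nat.not_even_iff_odd, even_iff_two_dvd]; exact hmo
    have hq2 : ¬ q % 2 = 0 := by omega
    simp only [hq2, if_false]
    have hcs : c = (if c < 0 then -1 else 1) * (2 ^ k * (m : ℤ)) := by
      have : ((c.natAbs : ℕ) : ℤ) = 2 ^ k * (m : ℤ) := by rw [← hprod]; push_cast; rfl
      split_ifs <;> omega
    have key : legendreSym p c = (if c < 0 then legendreSym p (-1) else 1) * (legendreSym p 2 ^ k * legendreSym p m) := by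
      conv_lhs => rw [hcs]
      rw [legendreSym.mul, legendreSym.mul]
      congr 1
      · split_ifs
        · rfl
        · simp
      · congr 1
        exact map_pow (legendreSym.hom p) 2 k
    rw [key, mul_assoc]
    congr 1
    · rw [legendreSym.at_neg_one hp2]
      rcases hqcase with ⟨h, h'⟩ | ⟨h, h'⟩
      · rw [ZMod.χ₄_nat_one_mod_four h]
        have : ¬ q < 0 := by omega
        simp [this]
      · rw [ZMod.χ₄_nat_three_mod_four h]
        have : q < 0 := by omega
        simp [this]
    congr 1
    · congr 1
      rw [legendreSym.at_two hp2, ZMod.χ₈_nat_eq_if_mod_eight]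
      have : ¬ p % 2 = 0 := by omega
      simp only [this, if_false]
      have : (q % 8 = 1 ∨ q % 8 = 7) ↔ (p % 8 = 1 ∨ p % 8 = 7) := by omega
      simp only [this]
    · rw [jacobiSym.legendreSym.to_jacobiSym]
      rcases hqcase with ⟨h, h'⟩ | ⟨h, h'⟩
      · rw [h', jacobiSym.quadratic_reciprocity_one_mod_four h hmodd]
      · rw [h', neg_eq_neg_one_mul, jacobiSym.mul_left, jacobiSym.at_neg_one hmodd]
        rcases Nat.odd_mod_four_iff.mp (Nat.odd_iff.mp hmodd) with hh | hh
        · rw [ZMod.χ₄_nat_one_mod_four hh, jacobiSym.quadratic_reciprocity_one_mod_four' hodd' hh, one_mul]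
        · rw [ZMod.χ₄_nat_three_mod_four hh, jacobiSym.quadratic_reciprocity_three_mod_four h hh]; ring

/-- The properties propagated by induction. -/
def AuxGood (d : ℤ) : Prop :=
  d ≠ 0 ∧ (∀ a b : ℤ, d ∣ a - b → kronecker d a = kronecker d b) ∧
  (∀ a b : ℤ, kronecker d (a * b) = kronecker d a * kronecker d b) ∧
  ∀ n : ℤ, ∑ c ∈ Finset.range d.natAbs,
        (kronecker d c : ℂ) * eexp (n * c / (d.natAbs : ℂ)) =
      (kronecker d n : ℂ) * Real.sqrt (d.natAbs) *
        (if 0 < d then 1 else Complex.I)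

lemma aux_eexp_add (x y : ℂ) : eexp (x + y) = eexp x * eexp y := by
  unfold eexp; rw [← Complex.exp_add]; ring_nf

lemma aux_eexp_int (k : ℤ) : eexp k = 1 := by
  unfold eexp
  rw [Complex.exp_eq_one_iff]
  exact ⟨k, by ring⟩

lemma aux_eexp_per (N : ℕ) (hN : N ≠ 0) (n a b : ℤ) (h : (N : ℤ) ∣ a - b) :
    eexp (n * a / N) = eexp (n * b / N) := by
  obtain ⟨k, hk⟩ := h
  have hN' : (N : ℂ) ≠ 0 := by exact_mod_cast hN
  have : a = b + N * k := by linarith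
  rw [this, show (n * ((b + N * k : ℤ) : ℂ) / N) = n * b / N + ((n * k : ℤ) : ℂ) by push_cast; field_simp,
    aux_eexp_add, aux_eexp_int, mul_one]

lemma aux_eexp_pow (N : ℕ) (hN : N ≠ 0) (n : ℤ) (c : ℕ) :
    eexp (n * c / N) = eexp (1 / N) ^ ((n % N).toNat * c) := by
  have hN0 : (N : ℤ) ≠ 0 := by exact_mod_cast hN
  have h1 : ((n % N).toNat : ℤ) = n % N := Int.toNat_of_nonneg (Int.emod_nonneg _ hN0)
  have h2 := aux_eexp_per N hN c n (n % N) (by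
    exact ⟨n / N, by linarith [Int.mul_ediv_add_emod n N]⟩)
  rw [← h1] at h2
  rw [mul_comm (n : ℂ)]
  push_cast at h2
  rw [h2]
  unfold eexp
  rw [← Complex.exp_nat_mul]
  congr 1
  push_cast
  ring

lemma aux_crt (A B : ℕ) (hA : A ≠ 0) (hB : B ≠ 0) (hAB : Nat.Coprime A B) (F : ℤ → ℂ)
    (hF : ∀ a b : ℤ, ((A * B : ℕ) : ℤ) ∣ a - b → F a = F b) :
    ∑ c ∈ Finset.range (A * B), F c = ∑ a ∈ Finset.range A, ∑ b ∈ Finset.range B, F (a * B + b * A) := by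
  rw [← Finset.sum_product']
  symm
  have hAB0 : 0 < A * B := Nat.mul_pos (Nat.pos_of_ne_zero hA) (Nat.pos_of_ne_zero hB)
  have hmaps : Set.MapsTo (fun x : ℕ × ℕ => (x.1 * B + x.2 * A) % (A * B)) (Finset.range A ×ˢ Finset.range B : Finset (ℕ × ℕ)) (Finset.range (A * B)) := by
    intro x _
    simpa using Nat.mod_lt _ hAB0
  have hinj : Set.InjOn (fun x : ℕ × ℕ => (x.1 * B + x.2 * A) % (A * B)) (Finset.range A ×ˢ Finset.range B : Finset (ℕ × ℕ)) := by
    rintro ⟨a, b⟩ hx ⟨a', b'⟩ hy hxy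
    simp only [Finset.coe_product, Set.mem_prod, Finset.mem_coe, Finset.mem_range] at hx hy
    have h : a * B + b * A ≡ a' * B + b' * A [MOD A * B] := hxy
    have h1 : a * B ≡ a' * B [MOD A] := by
      have := h.of_mul_right B
      have e : ∀ u v : ℕ, u * B + v * A ≡ u * B [MOD A] := fun u v => by
        simp [Nat.ModEq]
      exact (e a b).symm.trans (this.trans (e a' b'))
    have h2 : b * A ≡ b' * A [MOD B] := by
      have := h.of_mul_left A
      have e : ∀ u v : ℕ, u * B + v * A ≡ v * A [MOD B] := fun u v => by
        simp [Nat.ModEq]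
      exact (e a b).symm.trans (this.trans (e a' b'))
    have h3 := Nat.ModEq.cancel_right_of_coprime hAB h1
    have h4 := Nat.ModEq.cancel_right_of_coprime hAB.symm h2
    rw [Prod.mk.injEq]
    exact ⟨h3.eq_of_lt_of_lt hx.1 hy.1, h4.eq_of_lt_of_lt hx.2 hy.2⟩
  refine Finset.sum_nbij (fun x : ℕ × ℕ => (x.1 * B + x.2 * A) % (A * B)) hmaps hinj ?_ ?_
  · exact Finset.surjOn_of_injOn_of_card_le _ hmaps hinj (by simp)
  · rintro ⟨a, b⟩ _
    apply hF
    refine ⟨((a * B + b * A : ℕ) / (A * B : ℕ) : ℤ), ?_⟩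
    have := Int.mul_ediv_add_emod ((a * B + b * A : ℕ) : ℤ) ((A * B : ℕ) : ℤ)
    push_cast at this ⊢
    linarith

lemma aux_kron_odd_prime (d : ℤ) (p : ℕ) [Fact p.Prime] (hp2 : p ≠ 2) :
    kronecker d p = legendreSym p d := by
  have hp := (Fact.out : p.Prime)
  have hf : p.factorization 2 = 0 := by
    rw [Nat.Prime.factorization hp]; simp [hp2]
  unfold kronecker
  rw [jacobiSym.legendreSym.to_jacobiSym]
  have h0 : ¬ ((p : ℤ) < 0) := by omega
  have h1 : ¬ ((p : ℤ) = 0) := by have := hp.pos; omega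
  simp only [h0, h1, if_false, false_and, Int.natAbs_natCast, hf]
  simp

lemma aux_step (d : ℤ) (hd : AuxGood d) (p : ℕ) [Fact p.Prime] (hp2 : p ≠ 2) (hpd : ¬ (p : ℤ) ∣ d) :
    AuxGood ((if p % 4 = 1 then (p : ℤ) else -p) * d) := by
  have hp := (Fact.out : p.Prime)
  have hodd := hp.eq_two_or_odd.resolve_left hp2
  obtain ⟨hd0, hper, hmul, hG⟩ := hd
  have hkq := aux_kron_prime p hp2
  set q : ℤ := if p % 4 = 1 then (p : ℤ) else -p with hq
  have hqcase : (p % 4 = 1 ∧ q = p) ∨ (p % 4 = 3 ∧ q = -p) := by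
    rcases (by omega : p % 4 = 1 ∨ p % 4 = 3) with h | h
    · left; exact ⟨h, by simp [hq, h]⟩
    · right; exact ⟨h, by simp [hq, h]⟩
  clear_value q
  have hp0 : 0 < p := hp.pos
  have hq0 : q ≠ 0 := by omega
  have hqabs : q.natAbs = p := by omega
  have hkm : ∀ c, kronecker (q * d) c = legendreSym p c * kronecker d c := fun c => by
    rw [aux_kron_mul_left q d c hq0 hd0, hkq]
  have hlper : ∀ a b : ℤ, (p : ℤ) ∣ a - b → legendreSym p a = legendreSym p b := by
    intro a b h
    rw [legendreSym, legendreSym, (ZMod.intCast_eq_intCast_iff_dvd_sub b a p).2 h]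
  have hpq : (p : ℤ) ∣ q := by
    rcases hqcase with h | h <;> rw [h.2] <;> simp
  have hperq : ∀ a b : ℤ, q * d ∣ a - b → kronecker (q * d) a = kronecker (q * d) b := by
    intro a b h
    rw [hkm, hkm, hper a b ((Dvd.intro_left q rfl).trans h), hlper a b ((hpq.trans (Dvd.intro d rfl)).trans h)]
  refine ⟨mul_ne_zero hq0 hd0, hperq, ?_, ?_⟩
  · intro a b
    rw [hkm, hkm, hkm, hmul, legendreSym.mul]; ring
  · intro n
    rw [Int.natAbs_mul, hqabs]
    set D := d.natAbs with hD
    have hDd : d ∣ (D : ℤ) := Int.dvd_natAbs.2 dvd_rfl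
    have hD0 : D ≠ 0 := by simpa [hD] using hd0
    have hcop : Nat.Coprime p D := by
      rw [Nat.Prime.coprime_iff_not_dvd hp, hD, ← Int.natCast_dvd]; exact hpd
    have hpD0 : p * D ≠ 0 := Nat.mul_ne_zero hp0.ne' hD0
    have hpc : (p : ℂ) ≠ 0 := by exact_mod_cast hp0.ne'
    have hDc : (D : ℂ) ≠ 0 := by exact_mod_cast hD0
    have hcrt := aux_crt p D hp0.ne' hD0 hcop
      (fun c => (kronecker (q * d) c : ℂ) * eexp (n * c / ((p * D : ℕ) : ℂ))) (by
        intro a b h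
        rw [aux_eexp_per (p * D) hpD0 n a b h, hperq a b]
        refine dvd_trans ?_ h
        rw [← Int.natAbs_dvd_natAbs, Int.natAbs_mul, hqabs, Int.natAbs_natCast])
    simp only [Int.cast_natCast] at hcrt
    rw [hcrt]
    have hterm : ∀ a b : ℕ, (kronecker (q * d) (a * D + b * p) : ℂ) * eexp (n * ((a * D + b * p : ℤ) : ℂ) / ((p * D : ℕ) : ℂ)) =
        ((legendreSym p D * kronecker d p : ℤ) : ℂ) * (((legendreSym p a : ℂ) * eexp (n * a / p)) * ((kronecker d b : ℂ) * eexp (n * b / D))) := by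
      intro a b
      rw [hkm, hper (a * D + b * p) (b * p) (by simpa using hDd.mul_left _), hlper (a * D + b * p) (a * D) (by simp), hmul, legendreSym.mul,
        show (n * ((a * D + b * p : ℤ) : ℂ) / ((p * D : ℕ) : ℂ)) = n * a / p + n * b / D by push_cast; field_simp, aux_eexp_add]
      push_cast
      ring
    simp_rw [hterm]
    simp_rw [← Finset.mul_sum]
    rw [← Finset.sum_mul, aux_prime_gauss p hp2 n, hG n, hkm, aux_kron_odd_prime d p hp2]
    have hld : (legendreSym p d) ^ 2 = 1 := by
      apply legendreSym.sq_one
      rwa [Ne, ZMod.intCast_zmod_eq_zero_iff_dvd]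
    have hsgn : ((legendreSym p D * legendreSym p d : ℤ) : ℂ) * ((if p % 4 = 1 then 1 else I) * (if 0 < d then 1 else I)) = if 0 < q * d then 1 else I := by
      have hpz : (0:ℤ) < p := by exact_mod_cast hp0
      rcases lt_or_gt_of_ne hd0 with hneg | hpos
      · have e : (D : ℤ) = -1 * d := by omega
        rw [e, legendreSym.mul, mul_assoc, ← sq, hld, mul_one, legendreSym.at_neg_one hp2]
        rcases hqcase with ⟨h, h'⟩ | ⟨h, h'⟩
        · rw [ZMod.χ₄_nat_one_mod_four h]
          have : ¬ 0 < q * d := by rw [h']; nlinarith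
          simp [this, h, not_lt.2 hneg.le]
        · rw [ZMod.χ₄_nat_three_mod_four h]
          have : 0 < q * d := by rw [h']; nlinarith
          simp [this, h, not_lt.2 hneg.le]
      · have e : (D : ℤ) = d := by omega
        rw [e, ← sq, hld]
        rcases hqcase with ⟨h, h'⟩ | ⟨h, h'⟩
        · have : 0 < q * d := by rw [h']; positivity
          simp [this, h, hpos]
        · have : ¬ 0 < q * d := by rw [h']; nlinarith
          simp [this, h, hpos]
    rw [← hsgn]
    have hs : (Real.sqrt ((p * D : ℕ) : ℝ) : ℂ) = Real.sqrt p * Real.sqrt D := by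
      push_cast
      rw [Real.sqrt_mul (by positivity)]
      push_cast; rfl
    rw [hs]
    push_cast
    ring

lemma aux_kron_even (d : ℤ) (N : ℕ) (χ : MulChar (ZMod N) ℤ) (hd : d % 2 = 0) (hd0 : d ≠ 0)
    (h1 : ∀ m : ℕ, Odd m → jacobiSym d m = χ m) (h2 : ∀ x, χ (2 * x) = 0)
    (h3 : χ (-1) = if d < 0 then -1 else 1) (c : ℤ) : kronecker d c = χ c := by
  unfold kronecker
  by_cases hc : c = 0
  · subst hc
    have := h2 0
    have h : ¬ (d = 1 ∨ d = -1) := by omega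
    simp only [mul_zero] at this
    simp [h, this]
  · simp only [hc, if_false, hd, if_true]
    by_cases he : 2 ∣ c
    · obtain ⟨x, rfl⟩ := he
      have hf : (2 * x).natAbs.factorization 2 ≠ 0 := by
        have : 0 < (2 * x).natAbs.factorization 2 :=
          Nat.Prime.factorization_pos_of_dvd Nat.prime_two (by simpa using hc) (by simp [Int.natAbs_mul])
        omega
      push_cast
      simp [hf, h2]
    · have hf : c.natAbs.factorization 2 = 0 := by
        apply Nat.factorization_eq_zero_of_not_dvd
        omega
      simp only [hf, if_true, pow_zero, Nat.div_one, mul_one]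
      rw [h1 _ (by rw [Nat.odd_iff]; omega)]
      by_cases hneg : c < 0
      · have e : (c : ZMod N) = -1 * (c.natAbs : ZMod N) := by
          have : c = -1 * (c.natAbs : ℤ) := by omega
          conv_lhs => rw [this]
          rw [Int.cast_mul, Int.cast_natCast]; simp only [Int.cast_neg, Int.cast_one]
        rw [e, map_mul, h3]
        simp [hneg]
      · have e : (c : ZMod N) = (c.natAbs : ZMod N) := by
          have : c = (c.natAbs : ℤ) := by omega
          conv_lhs => rw [this]
          rw [Int.cast_natCast]
        rw [e]; simp [hneg]

lemma aux_good_even (d : ℤ) (N : ℕ) (hN : N = d.natAbs) (χ : MulChar (ZMod N) ℤ) (hd : d % 2 = 0) (hd0 : d ≠ 0)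
    (h1 : ∀ m : ℕ, Odd m → jacobiSym d m = χ m) (h2 : ∀ x, χ (2 * x) = 0)
    (h3 : χ (-1) = if d < 0 then -1 else 1)
    (h4 : ∀ r < N, ∑ c ∈ Finset.range N, (χ c : ℂ) * eexp (1 / N) ^ (r * c) = (χ r : ℂ) * Real.sqrt N *
        (if 0 < d then 1 else Complex.I)) : AuxGood d := by
  have hk := aux_kron_even d N χ hd hd0 h1 h2 h3
  have hN0 : N ≠ 0 := by simpa [hN] using hd0
  refine ⟨hd0, ?_, ?_, ?_⟩
  · intro a b h
    rw [hk, hk, (ZMod.intCast_eq_intCast_iff_dvd_sub b a N).2 (by rw [hN]; exact Int.natAbs_dvd.2 h)]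
  · intro a b
    rw [hk, hk, hk]; push_cast; rw [map_mul]
  · intro n
    rw [← hN]
    have hlt : (n % N).toNat < N := by
      have := Int.emod_lt_of_pos n (b := N) (by omega)
      have := Int.emod_nonneg n (b := N) (by omega)
      omega
    have := h4 _ hlt
    have e : (((n % N).toNat : ℕ) : ZMod N) = (n : ZMod N) := by
      have h : (((n % N).toNat : ℕ) : ℤ) = n % N := Int.toNat_of_nonneg (Int.emod_nonneg _ (by omega))
      have := congrArg (Int.cast : ℤ → ZMod N) h
      rw [ZMod.intCast_mod] at this
      exact_mod_cast this
    rw [e] at this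
    rw [hk, ← this]
    refine Finset.sum_congr rfl fun c _ => ?_
    rw [hk, aux_eexp_pow N hN0]; simp

lemma aux_z4 : eexp (1 / (4 : ℕ)) = I := by
  unfold eexp
  rw [show 2 * Real.pi * I * (1 / ((4:ℕ) : ℂ)) = Real.pi / 2 * I by push_cast; ring]
  exact Complex.exp_pi_div_two_mul_I

lemma aux_z8 : eexp (1 / (8 : ℕ)) = Real.sqrt 2 / 2 * (1 + I) := by
  unfold eexp
  rw [show 2 * Real.pi * I * (1 / ((8:ℕ) : ℂ)) = (Real.pi / 4 : ℝ) * I by push_cast; ring,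
    Complex.exp_mul_I, ← Complex.ofReal_cos, ← Complex.ofReal_sin, Real.cos_pi_div_four, Real.sin_pi_div_four]
  push_cast; ring

lemma aux_sqrt8 : (Real.sqrt ((8 : ℕ) : ℝ) : ℂ) = 2 * Real.sqrt 2 := by
  rw [show ((8 : ℕ) : ℝ) = 2 ^ 2 * 2 by norm_num, Real.sqrt_mul (by positivity), Real.sqrt_sq (by norm_num)]
  push_cast; rfl

lemma aux_sqrt2 : (Real.sqrt 2 : ℂ) ^ 2 = 2 := by
  rw [← ofReal_pow, Real.sq_sqrt (by norm_num)]; simp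

lemma aux_good_neg4 : AuxGood (-4) := by
  refine aux_good_even (-4) 4 rfl ZMod.χ₄ (by norm_num) (by norm_num) ?_ (by decide) (by decide) ?_
  · intro m hm
    rw [show (-4 : ℤ) = -1 * 4 by norm_num, jacobiSym.mul_left, jacobiSym.at_four hm, jacobiSym.at_neg_one hm, mul_one]
  · intro r hr
    rw [aux_z4]
    have v : ZMod.χ₄ 0 = 0 ∧ ZMod.χ₄ 1 = 1 ∧ ZMod.χ₄ 2 = 0 ∧ ZMod.χ₄ 3 = -1 := by decide
    have hs : (Real.sqrt ((4 : ℕ) : ℝ) : ℂ) = 2 := by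
      rw [show ((4 : ℕ) : ℝ) = 2 ^ 2 by norm_num, Real.sqrt_sq (by norm_num)]; simp
    rw [hs]
    have hI := I_sq
    generalize I = z at *
    interval_cases r <;> simp [Finset.sum_range_succ, v] <;> grind

lemma aux_good_8 : AuxGood 8 := by
  refine aux_good_even 8 8 rfl ZMod.χ₈ (by norm_num) (by norm_num) ?_ (by decide) (by decide) ?_
  · intro m hm
    rw [show (8 : ℤ) = 2 * 4 by norm_num, jacobiSym.mul_left, jacobiSym.at_four hm, jacobiSym.at_two hm, mul_one]
  · intro r hr
    rw [aux_z8, aux_sqrt8]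
    have v : ZMod.χ₈ 0 = 0 ∧ ZMod.χ₈ 1 = 1 ∧ ZMod.χ₈ 2 = 0 ∧ ZMod.χ₈ 3 = -1 ∧ ZMod.χ₈ 4 = 0 ∧ ZMod.χ₈ 5 = -1 ∧ ZMod.χ₈ 6 = 0 ∧ ZMod.χ₈ 7 = 1 := by decide
    have hI := I_sq
    have h2 := aux_sqrt2
    generalize (Real.sqrt 2 : ℂ) = s at *
    have hz : (s / 2 * (1 + I)) ^ 4 = -1 := by grind
    have hs : s = (s / 2 * (1 + I)) - (s / 2 * (1 + I)) ^ 3 := by grind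
    generalize (s / 2 * (1 + I)) = z at *
    interval_cases r <;> simp [Finset.sum_range_succ, v] <;> grind

lemma aux_good_neg8 : AuxGood (-8) := by
  refine aux_good_even (-8) 8 rfl ZMod.χ₈' (by norm_num) (by norm_num) ?_ (by decide) (by decide) ?_
  · intro m hm
    rw [show (-8 : ℤ) = -2 * 4 by norm_num, jacobiSym.mul_left, jacobiSym.at_four hm, jacobiSym.at_neg_two hm, mul_one]
  · intro r hr
    rw [aux_z8, aux_sqrt8]
    have v : ZMod.χ₈' 0 = 0 ∧ ZMod.χ₈' 1 = 1 ∧ ZMod.χ₈' 2 = 0 ∧ ZMod.χ₈' 3 = 1 ∧ ZMod.χ₈' 4 = 0 ∧ ZMod.χ₈' 5 = -1 ∧ ZMod.χ₈' 6 = 0 ∧ ZMod.χ₈' 7 = -1 := by decide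
    have hI := I_sq
    have h2 := aux_sqrt2
    generalize (Real.sqrt 2 : ℂ) = s at *
    have hz : (s / 2 * (1 + I)) ^ 4 = -1 := by grind
    have hs : s * I = (s / 2 * (1 + I)) + (s / 2 * (1 + I)) ^ 3 := by grind
    generalize (s / 2 * (1 + I)) = z at *
    interval_cases r <;> simp [Finset.sum_range_succ, v] <;> grind

lemma aux_good_one : AuxGood 1 := by
  have : ∀ c, kronecker 1 c = 1 := by
    intro c
    unfold kronecker
    by_cases hc : c = 0 <;> simp [hc, jacobiSym.one_left]
  refine ⟨one_ne_zero, ?_, ?_, ?_⟩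
  · intros; simp [this]
  · intros; simp [this]
  · intro n; simp [this, eexp]

lemma aux_all (N : ℕ) : ∀ d : ℤ, d.natAbs = N → IsFundamentalDiscriminant d → d ≠ 0 → AuxGood d := by
  induction N using Nat.strong_induction_on with
  | _ N ih =>
  intro d hdN hd hd0
  rcases Nat.eq_two_pow_or_exists_odd_prime_and_dvd N with ⟨k, hk⟩ | ⟨p, hp, hpN, hpo⟩
  · have hcase : d = 1 ∨ d = -4 ∨ d = 8 ∨ d = -8 := by
      rcases hd with ⟨h, -⟩ | ⟨h, -, h'⟩
      · rcases k with _ | k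
        · simp at hk; omega
        · rw [pow_succ] at hk; omega
      · rcases k with _ | _ | _ | _ | k
        · simp at hk; omega
        · simp at hk; omega
        · simp at hk; omega
        · simp at hk; omega
        · rw [pow_add] at hk; omega
    rcases hcase with rfl | rfl | rfl | rfl
    · exact aux_good_one
    · exact aux_good_neg4
    · exact aux_good_8
    · exact aux_good_neg8
  · haveI : Fact p.Prime := ⟨hp⟩
    have hp2 : p ≠ 2 := by rintro rfl; revert hpo; decide
    have hpo' : p % 2 = 1 := Nat.odd_iff.1 hpo
    have hp3 : 3 ≤ p := by have := hp.two_le; omega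
    have hpunit : ¬ IsUnit (p : ℤ) := by
      rw [Int.isUnit_iff]; omega
    obtain ⟨q, hq⟩ : ∃ q : ℤ, q = if p % 4 = 1 then (p : ℤ) else -p := ⟨_, rfl⟩
    have hqcase : (p % 4 = 1 ∧ q = p) ∨ (p % 4 = 3 ∧ q = -p) := by
      rcases (by omega : p % 4 = 1 ∨ p % 4 = 3) with h | h
      · left; exact ⟨h, by simp [hq, h]⟩
      · right; exact ⟨h, by simp [hq, h]⟩
    have hq4 : q % 4 = 1 := by omega
    have hqd : q ∣ d := by
      have : (p : ℤ) ∣ d := by rw [Int.natCast_dvd, hdN]; exact hpN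
      rcases hqcase with h | h <;> rw [h.2]
      · exact this
      · exact (neg_dvd).2 this
    have hpq : (p : ℤ) ∣ q := by
      rcases hqcase with h | h <;> rw [h.2] <;> simp
    obtain ⟨d', rfl⟩ := hqd
    have hd'0 : d' ≠ 0 := right_ne_zero_of_mul hd0
    have hmod : (q * d') % 4 = d' % 4 := by rw [Int.mul_emod, hq4]; simp
    have hlt : d'.natAbs < N := by
      rw [← hdN, Int.natAbs_mul]
      have h1 : 0 < d'.natAbs := Int.natAbs_pos.2 hd'0
      have h2 : 3 ≤ q.natAbs := by omega
      nlinarith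
    have hmain : IsFundamentalDiscriminant d' ∧ ¬ (p : ℤ) ∣ d' := by
      rcases hd with ⟨h, hs⟩ | ⟨h, hs, h'⟩
      · refine ⟨Or.inl ⟨by omega, hs.squarefree_of_dvd (Dvd.intro_left q rfl)⟩, fun hpd => ?_⟩
        exact hpunit (hs _ (mul_dvd_mul hpq hpd))
      · rw [hmod] at h
        obtain ⟨e, rfl⟩ := Int.dvd_of_emod_eq_zero h
        have e1 : q * (4 * e) / 4 = q * e := by
          rw [show q * (4 * e) = 4 * (q * e) by ring]; simp
        have e2 : 4 * e / 4 = e := by simp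
        have hmod' : (q * e) % 4 = e % 4 := by rw [Int.mul_emod, hq4]; simp
        rw [e1] at hs h'
        refine ⟨Or.inr ⟨h, ?_, ?_⟩, fun hpd => ?_⟩
        · rw [e2]; exact hs.squarefree_of_dvd (Dvd.intro_left q rfl)
        · rw [e2]; omega
        · have hpe : (p : ℤ) ∣ e := by
            have hpr : Prime (p : ℤ) := Nat.prime_iff_prime_int.1 hp
            rcases hpr.dvd_or_dvd hpd with h4 | h4
            · exfalso
              have h5 : p ∣ 2 ^ 2 := by exact_mod_cast h4
              have := (Nat.prime_dvd_prime_iff_eq hp Nat.prime_two).1 (hp.dvd_of_dvd_pow h5)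
              exact hp2 this
            · exact h4
          exact hpunit (hs _ (mul_dvd_mul hpq hpe))
    have := aux_step d' (ih _ hlt d' rfl hmain.1 hd'0) p hp2 hmain.2
    rw [← hq] at this
    exact this


/-- Evaluation of the Gauss sum of the real primitive character `χ_d = (d/·)`
twisted by the additive character with parameter `n`:
`G(n,d) = Σ_{c mod |d|} (d/c) e(nc/|d|) = (d/n)·√|d|` for `d > 0` and
`= (d/n)·i·√|d|` for `d < 0`. -/
theorem gauss_sum_eval
    (d : ℤ) (hd : IsFundamentalDiscriminant d) (hd0 : d ≠ 0) (n : ℤ) :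
    ∑ c ∈ Finset.range d.natAbs,
        (kronecker d c : ℂ) * eexp (n * c / (d.natAbs : ℂ)) =
      (kronecker d n : ℂ) * Real.sqrt (d.natAbs) *
        (if 0 < d then 1 else Complex.I) := by
  exact (aux_all _ d rfl hd hd0).2.2.2 n
end

section
/- For Re(s) > 1 and a positive fundamental discriminant d, the Dirichlet series identity Σ_{c=1}^∞ c^{−s−1/2} K⁺(d, 0; 4c) evaluates, when multiplied by Γ(s/2)² d^s L(s,χ_d)/(4Γ(s)), to Γ(s/2)² d^s L(s,χ_d)² / (Γ(s) ζ(2s)). Equivalently, Σ_{c=1}^∞ K⁺(d,0;4c) c^{−s−1/2} = 4 L(s, χ_d)/ζ(2s), where K⁺(p,q,c) = (1−i) Σ_{v mod c} (c/v) ε_v e((p v̄ + q v)/c) · (1 if 4 | c and c/4 even, 2 if c/4 odd), ε_v = 1 for v ≡ 1 mod 4 and ε_v = i for v ≡ 3 mod 4. -/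
open Complex

/-- The half-integral weight (plus space) Kloosterman sum `K⁺(p,q,c)` for `4 ∣ c`:
`(1−i) Σ_{v mod c, (v,c)=1} (c/v) ε_v e((p v̄ + q v)/c)`, doubled when `c/4` is odd.
Here `ε_v = 1` for `v ≡ 1 (mod 4)`, `ε_v = i` for `v ≡ 3 (mod 4)`. -/
noncomputable def Kplus (p q : ℤ) (c : ℕ) : ℂ :=
  (1 - Complex.I) * (if (c / 4) % 2 = 1 then 2 else 1) *
    ∑ v ∈ Finset.range c, if Nat.gcd v c = 1 then
      (kronecker c v : ℂ) * (if v % 4 = 1 then 1 else Complex.I) *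
        eexp ((p * ((((v : ZMod c)⁻¹).val : ℕ) : ℂ) + q * v) / c)
    else 0


namespace KD
open Filter Topology

lemma summable_gauss {z : ℂ} (hz : 0 < z.re) :
    Summable fun n : ℤ => cexp (-Real.pi * z * n ^ 2) := by
  have := (summable_jacobiTheta₂_term_iff 0 (I * z)).mpr (by simpa using hz)
  refine this.congr fun n => ?_
  rw [jacobiTheta₂_term]
  congr 1
  linear_combination (Real.pi * n ^ 2 * z : ℂ) * (I_mul_I)

lemma lemA {ι : Type*} {l : Filter ι} {w : ι → ℂ}
    (hw : Tendsto (fun i => (w i).re) l atTop) (x : ℝ) :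
    Tendsto (fun i => ∑' n : ℤ, cexp (-Real.pi * w i * n ^ 2 + 2 * Real.pi * (-I * x) * n)) l (𝓝 1) := by
  have key : ∀ (u : ℂ) (n : ℤ), ‖cexp (-Real.pi * u * n ^ 2 + 2 * Real.pi * (-I * x) * n)‖
      = Real.exp (-Real.pi * u.re * n ^ 2) := by
    intro u n
    rw [Complex.norm_exp]
    congr 1
    have : (-Real.pi * u * n ^ 2 + 2 * Real.pi * (-I * x) * n : ℂ)
      = ((Real.pi * (n:ℝ) ^ 2 : ℝ) : ℂ) * (-u) + ((2 * Real.pi * x * n : ℝ) : ℂ) * (-I) := by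
      push_cast; ring
    rw [this]
    simp only [add_re, re_ofReal_mul, neg_re, I_re]
    ring
  have h1 : Tendsto (fun i => ∑' n : ℤ, cexp (-Real.pi * w i * n ^ 2 + 2 * Real.pi * (-I * x) * n)) l
      (𝓝 (∑' n : ℤ, if n = 0 then 1 else 0)) := by
    refine tendsto_tsum_of_dominated_convergence (bound := fun n : ℤ => Real.exp (-Real.pi * n ^ 2)) ?_ ?_ ?_
    · have := (summable_gauss (z := 1) (by simp)).norm
      refine this.congr fun n => ?_
      rw [Complex.norm_exp]
      congr 1
      have : (-Real.pi * 1 * n ^ 2 : ℂ) = ((-Real.pi * (n:ℝ) ^ 2 : ℝ) : ℂ) := by push_cast; ring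
      rw [this, ofReal_re]
    · intro n
      by_cases hn : n = 0
      · subst hn; simp [tendsto_const_nhds]
      · simp only [hn, if_false]
        rw [tendsto_zero_iff_norm_tendsto_zero]
        simp_rw [key]
        refine Real.tendsto_exp_atBot.comp ?_
        have hp : 0 < Real.pi * (n:ℝ) ^ 2 := by positivity
        have := (hw.const_mul_atTop hp)
        have h2 := tendsto_neg_atTop_atBot.comp this
        refine h2.congr fun i => ?_
        simp only [Function.comp]; ring
    · filter_upwards [hw.eventually_ge_atTop 1] with i hi n
      rw [key]
      apply Real.exp_le_exp.mpr
      have hp : 0 ≤ Real.pi * (n:ℝ) ^ 2 := by positivity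
      nlinarith
  simpa using h1

lemma half_cpow_mul {r : ℝ} (hr : 0 < r) (z : ℂ) :
    ((r : ℂ) * z) ^ (1 / 2 : ℂ) = (Real.sqrt r : ℂ) * z ^ (1 / 2 : ℂ) := by
  by_cases hz : z = 0
  · simp [hz]
  have hr' : (r : ℂ) ≠ 0 := by exact_mod_cast hr.ne'
  rw [cpow_def_of_ne_zero (mul_ne_zero hr' hz), cpow_def_of_ne_zero hz,
    Complex.log_ofReal_mul hr hz, add_mul, Complex.exp_add]
  congr 1
  rw [Real.sqrt_eq_rpow, Real.rpow_def_of_pos hr]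
  push_cast; rfl

lemma T_eq {w : ℂ} (hw : 0 < w.re) (N : ℕ) (hN : 0 < N) (r : ℕ) :
    ∑' n : ℤ, cexp (-Real.pi / w * (N * n + r) ^ 2) =
      w ^ (1 / 2 : ℂ) / N * ∑' n : ℤ, cexp (-Real.pi * (w / N ^ 2) * n ^ 2
        + 2 * Real.pi * (-I * ((r / N : ℝ) : ℂ)) * n) := by
  have hN' : (N : ℂ) ≠ 0 := by exact_mod_cast hN.ne'
  have hw0 : w ≠ 0 := by rintro rfl; simp at hw
  have e : w / N ^ 2 = (((1 / (N:ℝ) ^ 2 : ℝ)) : ℂ) * w := by push_cast; ring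
  have hpos : 0 < (w / N ^ 2).re := by
    rw [e, re_ofReal_mul]; positivity
  rw [Complex.tsum_exp_neg_quadratic hpos]
  have h2 : (w / N ^ 2) ^ (1 / 2 : ℂ) = w ^ (1 / 2 : ℂ) / N := by
    rw [e, half_cpow_mul (by positivity)]
    rw [Real.sqrt_div (by norm_num), Real.sqrt_sq (by positivity)]
    push_cast; simp; ring
  have hne : w ^ (1 / 2 : ℂ) ≠ 0 := by simp [cpow_eq_zero_iff, hw0]
  rw [h2, ← mul_assoc, mul_one_div_cancel (div_ne_zero hne hN'), one_mul]
  refine tsum_congr fun n => ?_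
  congr 1
  have : I * (-I * ((r / N : ℝ) : ℂ)) = r / N := by
    push_cast; linear_combination (r / N : ℂ) * (-I_mul_I)
  rw [this]
  field_simp

lemma lemB {ι : Type*} {l : Filter ι} {w : ι → ℂ}
    (hw : Tendsto (fun i => (w i).re) l atTop) (N : ℕ) (hN : 0 < N) (q : ℤ → ℂ)
    (hq : ∀ (n : ℤ) (r : ℕ), q (N * n + r) = q r) :
    Tendsto (fun i => (w i ^ (1 / 2 : ℂ))⁻¹ * ∑' n : ℤ, q n * cexp (-Real.pi / w i * n ^ 2)) l
      (𝓝 ((∑ r ∈ Finset.range N, q r) / N)) := by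
  have hN' : (N : ℂ) ≠ 0 := by exact_mod_cast hN.ne'
  have : NeZero N := ⟨hN.ne'⟩
  have main : ∀ᶠ i in l, (∑ r ∈ Finset.range N, q r * ((∑' n : ℤ, cexp (-Real.pi * (w i / N ^ 2) * n ^ 2
        + 2 * Real.pi * (-I * ((r / N : ℝ) : ℂ)) * n)) / N)) =
      (w i ^ (1 / 2 : ℂ))⁻¹ * ∑' n : ℤ, q n * cexp (-Real.pi / w i * n ^ 2) := by
    filter_upwards [hw.eventually_gt_atTop 0] with i hi
    have hw0 : w i ≠ 0 := by intro h; rw [h] at hi; simp at hi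
    have hne : w i ^ (1 / 2 : ℂ) ≠ 0 := by simp [cpow_eq_zero_iff, hw0]
    have hinv : 0 < ((w i)⁻¹).re := by
      rw [inv_re]; exact div_pos hi (normSq_pos.mpr hw0)
    have hs0 : Summable fun n : ℤ => cexp (-Real.pi / w i * n ^ 2) := by
      refine (summable_gauss hinv).congr fun n => ?_
      rw [div_eq_mul_inv]
    have hs : Summable fun n : ℤ => q n * cexp (-Real.pi / w i * n ^ 2) := by
      have hb : ∃ C : ℝ, ∀ n : ℤ, ‖q n‖ ≤ C := by
        refine ⟨∑ r ∈ Finset.range N, ‖q r‖, fun n => ?_⟩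
        have h1 : q n = q ((n % N).toNat : ℕ) := by
          have h3 : 0 ≤ n % N := Int.emod_nonneg _ (by exact_mod_cast hN.ne')
          rw [← hq (n / N)]
          congr 1
          rw [Int.toNat_of_nonneg h3]
          exact (Int.mul_ediv_add_emod n N).symm
        rw [h1]
        refine Finset.single_le_sum (f := fun r : ℕ => ‖q r‖) (fun _ _ => norm_nonneg _) ?_
        have h4 : n % N < N := Int.emod_lt_of_pos _ (by exact_mod_cast hN)
        simp; omega
      obtain ⟨C, hC⟩ := hb
      refine Summable.of_norm_bounded (g := fun n : ℤ => C * ‖cexp (-Real.pi / w i * n ^ 2)‖)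
        (hs0.norm.mul_left C) fun n => ?_
      rw [norm_mul]; gcongr; exact hC n
    have hs' := (Int.divModEquiv N).symm.summable_iff.mpr hs
    rw [← (Int.divModEquiv N).symm.tsum_eq]
    rw [← (Equiv.prodComm (Fin N) ℤ).tsum_eq]
    have hs'' := (Equiv.prodComm (Fin N) ℤ).summable_iff.mpr hs'
    rw [Summable.tsum_prod (by exact hs'')]
    rw [tsum_fintype, Finset.mul_sum, ← Fin.sum_univ_eq_sum_range
      (fun r => q r * ((∑' n : ℤ, cexp (-Real.pi * (w i / N ^ 2) * n ^ 2
        + 2 * Real.pi * (-I * ((r / N : ℝ) : ℂ)) * n)) / N))]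
    refine Finset.sum_congr rfl fun r _ => ?_
    have h5 : ∀ n : ℤ, q ((Int.divModEquiv N).symm ((Equiv.prodComm (Fin N) ℤ) (r, n))) *
        cexp (-Real.pi / w i * (((Int.divModEquiv N).symm ((Equiv.prodComm (Fin N) ℤ) (r, n)) : ℤ):ℂ) ^ 2)
        = q (r : ℕ) * cexp (-Real.pi / w i * (N * n + (r : ℕ)) ^ 2) := by
      intro n
      have h6 : (Int.divModEquiv N).symm ((Equiv.prodComm (Fin N) ℤ) (r, n)) = N * n + (r : ℕ) := by
        simp [Int.divModEquiv_symm_apply]; try ring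
      rw [h6, hq]; push_cast; rfl
    simp_rw [h5]
    rw [tsum_mul_left, T_eq hi N hN]
    field_simp
  refine Tendsto.congr' main ?_
  rw [Finset.sum_div]
  refine tendsto_finsetSum _ fun r _ => ?_
  have hw2 : Tendsto (fun i => (w i / N ^ 2).re) l atTop := by
    have hp : (0:ℝ) < 1 / (N:ℝ) ^ 2 := by positivity
    refine (hw.const_mul_atTop hp).congr fun i => ?_
    have e : w i / N ^ 2 = (((1 / (N:ℝ) ^ 2 : ℝ)) : ℂ) * w i := by push_cast; ring
    rw [e, re_ofReal_mul]
  have := ((lemA hw2 (r / N : ℝ)).div_const (N : ℂ)).const_mul (q r)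
  simpa [div_eq_mul_inv] using this


lemma negI_half : (-I) ^ (1 / 2 : ℂ) = (1 - I) / (Real.sqrt 2 : ℂ) := by
  rw [cpow_def_of_ne_zero (by simp), Complex.log_neg_I]
  have : (-(Real.pi / 2) * I * (1 / 2) : ℂ) = ((-(Real.pi / 4) : ℝ) : ℂ) * I := by push_cast; ring
  rw [this, Complex.exp_mul_I, ← ofReal_cos, ← ofReal_sin, Real.cos_neg, Real.sin_neg,
    Real.cos_pi_div_four, Real.sin_pi_div_four]
  have h2 : (Real.sqrt 2 : ℂ) ≠ 0 := by simp
  have h3 : (Real.sqrt 2 : ℂ) * Real.sqrt 2 = 2 := by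
    rw [← ofReal_mul]; simp
  push_cast
  field_simp
  linear_combination (1 - I) * h3

lemma recip0 (a c : ℕ) (ha : 0 < a) (hc : 0 < c) (he : 2 ∣ a * c) :
    (1 - I) / (Real.sqrt 2 : ℂ) * (Real.sqrt (a / c) : ℂ) *
      ∑ r ∈ Finset.range c, cexp (Real.pi * I * a * r ^ 2 / c) =
    ∑ r ∈ Finset.range a, cexp (-Real.pi * I * c * r ^ 2 / a) := by
  have ha' : (a : ℂ) ≠ 0 := by exact_mod_cast ha.ne'
  have hc' : (c : ℂ) ≠ 0 := by exact_mod_cast hc.ne'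
  have haR : (0:ℝ) < a := by exact_mod_cast ha
  have hcR : (0:ℝ) < c := by exact_mod_cast hc
  obtain ⟨k, hk⟩ := he
  have hkC : (a : ℂ) * c = 2 * k := by exact_mod_cast hk
  -- left limit
  have L := lemB (l := atTop) (w := fun t : ℝ => (t : ℂ)) (by simp only [ofReal_re]; exact tendsto_id) c hc
    (fun n => cexp (Real.pi * I * a * n ^ 2 / c)) (by
      intro n r
      rw [Complex.exp_eq_exp_iff_exists_int]
      refine ⟨k * n ^ 2 + a * n * r, ?_⟩
      push_cast
      field_simp
      linear_combination (n ^ 2 * c : ℂ) * hkC)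
  have R := lemB (l := atTop) (w := fun t : ℝ => (((a / c : ℝ) ^ 2 * t : ℝ) : ℂ) + I * (a / c : ℝ)) (by
      have : Tendsto (fun t : ℝ => (a / c : ℝ) ^ 2 * t) atTop atTop :=
        tendsto_id.const_mul_atTop (by positivity)
      refine this.congr fun t => ?_
      simp [-ofReal_div, -ofReal_natCast, -ofReal_mul, -ofReal_pow]) a ha
    (fun n => cexp (-Real.pi * I * c * n ^ 2 / a)) (by
      intro n r
      rw [Complex.exp_eq_exp_iff_exists_int]
      refine ⟨-(k * n ^ 2 + c * n * r), ?_⟩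
      push_cast
      field_simp
      linear_combination (-n ^ 2 * a : ℂ) * hkC)
  set B : ℝ → ℂ := fun t => ((((a / c : ℝ) ^ 2 : ℝ) : ℂ) + I * (a / c : ℝ) * ((t⁻¹ : ℝ) : ℂ)) ^ (1 / 2 : ℂ)
  set A : ℝ → ℂ := fun t => (-I * (a / c : ℝ) + ((t⁻¹ : ℝ) : ℂ)) ^ (1 / 2 : ℂ)
  have hinv : Tendsto (fun t : ℝ => ((t⁻¹ : ℝ) : ℂ)) atTop (𝓝 0) := by
    have := (Complex.continuous_ofReal.tendsto 0).comp tendsto_inv_atTop_zero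
    rw [ofReal_zero] at this
    exact this
  have hB : Tendsto B atTop (𝓝 ((a / c : ℝ) : ℂ)) := by
    have h1 : Tendsto (fun t : ℝ => (((a / c : ℝ) ^ 2 : ℝ) : ℂ) + I * (a / c : ℝ) * ((t⁻¹ : ℝ) : ℂ)) atTop
        (𝓝 ((((a / c : ℝ) ^ 2 : ℝ) : ℂ))) := by
      have := (hinv.const_mul (I * (a / c : ℝ))).const_add (((a / c : ℝ) ^ 2 : ℝ) : ℂ)
      rw [mul_zero, add_zero] at this
      exact this
    have h2 := (continuousAt_cpow_const (a := (((a / c : ℝ) ^ 2 : ℝ) : ℂ)) (b := 1 / 2)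
      (by rw [ofReal_mem_slitPlane]; positivity)).tendsto.comp h1
    have h3 : ((((a / c : ℝ) ^ 2 : ℝ) : ℂ)) ^ (1 / 2 : ℂ) = ((a / c : ℝ) : ℂ) := by
      have := half_cpow_mul (r := (a / c : ℝ) ^ 2) (by positivity) 1
      rw [mul_one, one_cpow, mul_one, Real.sqrt_sq (by positivity)] at this
      exact this
    rw [h3] at h2
    exact h2
  have hA : Tendsto A atTop (𝓝 ((1 - I) / (Real.sqrt 2 : ℂ) * (Real.sqrt (a / c) : ℂ))) := by
    have h1 : Tendsto (fun t : ℝ => -I * (a / c : ℝ) + ((t⁻¹ : ℝ) : ℂ)) atTop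
        (𝓝 (-I * (a / c : ℝ))) := by
      simpa using hinv.const_add (-I * ((a / c : ℝ) : ℂ))
    have h2 := (continuousAt_cpow_const (a := -I * ((a / c : ℝ) : ℂ)) (b := 1 / 2)
      (by
        rw [mem_slitPlane_iff]; right
        rw [mul_comm, im_ofReal_mul]
        simp [ha.ne', hc.ne'])).tendsto.comp h1
    rw [mul_comm (-I), half_cpow_mul (by positivity), negI_half, mul_comm (Real.sqrt (a / c) : ℂ)] at h2
    refine h2.congr fun t => ?_
    simp only [A, Function.comp, mul_comm]
  have hAne : (1 - I) / (Real.sqrt 2 : ℂ) * (Real.sqrt (a / c) : ℂ) ≠ 0 := by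
    have : (1 - I : ℂ) ≠ 0 := by
      intro h; have := congrArg re h; simp at this
    have h2 : (Real.sqrt (a / c) : ℂ) ≠ 0 := by
      have : 0 < Real.sqrt (a / c) := by positivity
      exact_mod_cast this.ne'
    have h3 : (Real.sqrt 2 : ℂ) ≠ 0 := by simp
    positivity
  have R2 := (hB.div hA hAne).mul R
  have heq := tendsto_nhds_unique (R2.congr' ?_) L
  · simp only [Int.cast_natCast] at heq
    set X := (1 - I) / (Real.sqrt 2 : ℂ) * (Real.sqrt (a / c) : ℂ)
    push_cast at heq
    have hX : X ≠ 0 := hAne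
    generalize (∑ r ∈ Finset.range c, cexp (Real.pi * I * a * r ^ 2 / c)) = S1 at heq ⊢
    generalize (∑ r ∈ Finset.range a, cexp (-Real.pi * I * c * r ^ 2 / a)) = S2 at heq ⊢
    clear_value X
    field_simp at heq
    exact heq.symm
  · filter_upwards [eventually_gt_atTop 0] with t ht
    have ht' : (t : ℂ) ≠ 0 := by exact_mod_cast ht.ne'
    have hw : (((a / c : ℝ) ^ 2 * t : ℝ) : ℂ) + I * (a / c : ℝ) =
        (t : ℂ) * ((((a / c : ℝ) ^ 2 : ℝ) : ℂ) + I * (a / c : ℝ) * ((t⁻¹ : ℝ) : ℂ)) := by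
      push_cast; field_simp
    have hw2 : ((((a / c : ℝ) ^ 2 * t : ℝ) : ℂ) + I * (a / c : ℝ)) ^ (1 / 2 : ℂ) =
        (t : ℂ) ^ (1 / 2 : ℂ) * B t := by
      have h1 := half_cpow_mul ht 1
      rw [mul_one, one_cpow, mul_one] at h1
      rw [hw, half_cpow_mul ht, h1]
    have hBne : B t ≠ 0 := by
      simp only [B, ne_eq, cpow_eq_zero_iff, not_and_or]
      left
      intro h
      have := congrArg re h
      simp [-ofReal_div, -ofReal_natCast, -ofReal_mul, -ofReal_pow, -ofReal_inv] at this
      have h4 : (0:ℝ) < (a / c) ^ 2 := by positivity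
      simp [ha.ne', hc.ne'] at this
    have hre : 0 < (-I * (a / c : ℝ) + ((t⁻¹ : ℝ) : ℂ)).re := by
      have : 0 < t⁻¹ := by positivity
      simpa [-ofReal_div, -ofReal_natCast, -ofReal_mul, -ofReal_pow, -ofReal_inv] using this
    have hne : (-I * (a / c : ℝ) + ((t⁻¹ : ℝ) : ℂ)) ≠ 0 := by
      intro h; rw [h] at hre; simp at hre
    have F := Complex.tsum_exp_neg_mul_int_sq hre
    have e1 : ∑' n : ℤ, cexp (Real.pi * I * a * n ^ 2 / c) * cexp (-Real.pi / t * n ^ 2) =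
        ∑' n : ℤ, cexp (-Real.pi * (-I * (a / c : ℝ) + ((t⁻¹ : ℝ) : ℂ)) * n ^ 2) := by
      refine tsum_congr fun n => ?_
      rw [← Complex.exp_add]
      congr 1
      push_cast
      field_simp
      ring
    have e2 : ∑' n : ℤ, cexp (-Real.pi * I * c * n ^ 2 / a) *
        cexp (-Real.pi / ((((a / c : ℝ) ^ 2 * t : ℝ) : ℂ) + I * (a / c : ℝ)) * n ^ 2) =
        ∑' n : ℤ, cexp (-Real.pi / (-I * (a / c : ℝ) + ((t⁻¹ : ℝ) : ℂ)) * n ^ 2) := by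
      refine tsum_congr fun n => ?_
      rw [← Complex.exp_add]
      congr 1
      have h5 : (((a / c : ℝ) ^ 2 * t : ℝ) : ℂ) + I * (a / c : ℝ) =
        I * (a / c) * t * (-I * (a / c : ℝ) + ((t⁻¹ : ℝ) : ℂ)) := by
        push_cast; field_simp
        linear_combination (a * t : ℂ) * I_mul_I
      rw [h5]
      set Y := (-I * (a / c : ℝ) + ((t⁻¹ : ℝ) : ℂ)) with hY
      have hY2 : Y * c * t = -I * a * t + c := by
        rw [hY]; push_cast; field_simp
      have : I ≠ 0 := I_ne_zero
      clear_value Y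
      field_simp
      linear_combination (n ^ 2 : ℂ) * hY2 - (c * t * Y * n ^ 2 :ℂ) * I_mul_I
    rw [e2, e1, F, hw2]
    have hAt : (-I * (a / c : ℝ) + ((t⁻¹ : ℝ) : ℂ)) ^ (1 / 2 : ℂ) = A t := rfl
    rw [hAt]
    have ht2 : (t : ℂ) ^ (1 / 2 : ℂ) ≠ 0 := by simp [cpow_eq_zero_iff, ht']
    have hAt0 : A t ≠ 0 := by
      rw [← hAt]; rw [Ne, cpow_eq_zero_iff]; exact fun h => hne h.1
    simp only [Pi.div_apply]
    field_simp

/-- quadratic Gauss sum -/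
noncomputable def gs (b : ℤ) (c : ℕ) : ℂ :=
  ∑ x ∈ Finset.range c, cexp (2 * Real.pi * I * b * x ^ 2 / c)

lemma gs_four (b c : ℕ) (hb : 0 < b) :
    starRingEnd ℂ (gs c (4 * b)) = 2 * ∑ r ∈ Finset.range (2 * b), cexp (-Real.pi * I * c * r ^ 2 / (2 * b : ℕ)) := by
  have hb' : (b : ℂ) ≠ 0 := by exact_mod_cast hb.ne'
  have h4 : 4 * b = 2 * b + 2 * b := by ring
  have h0 : ∀ x : ℕ, starRingEnd ℂ (cexp (2 * Real.pi * I * (c : ℤ) * x ^ 2 / (4 * b : ℕ))) =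
      cexp (-Real.pi * I * c * x ^ 2 / (2 * b : ℕ)) := by
    intro x
    rw [← Complex.exp_conj]
    congr 1
    simp
    rw [map_ofNat, map_ofNat]
    field_simp
    ring
  rw [gs, map_sum, Finset.sum_congr rfl (fun x _ => h0 x), h4, Finset.sum_range_add, two_mul (Finset.sum _ _)]
  congr 1
  refine Finset.sum_congr rfl fun x _ => ?_
  rw [Complex.exp_eq_exp_iff_exists_int]
  refine ⟨-(c * b + c * x), ?_⟩
  push_cast
  field_simp
  ring

lemma recip (b c : ℕ) (hb : 0 < b) (hc : 0 < c) :
    2 * (1 - I) * (Real.sqrt b : ℂ) * gs b c = (Real.sqrt c : ℂ) * starRingEnd ℂ (gs c (4 * b)) := by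
  rw [gs_four b c hb, ← recip0 (2 * b) c (by omega) hc ⟨b * c, by ring⟩]
  have h1 : ∑ r ∈ Finset.range c, cexp (Real.pi * I * (2 * b : ℕ) * r ^ 2 / c) = gs b c := by
    rw [gs]
    refine Finset.sum_congr rfl fun x _ => ?_
    congr 1; push_cast; ring
  rw [h1]
  have h2 : Real.sqrt ((2 * b : ℕ) / c) = Real.sqrt 2 * Real.sqrt b / Real.sqrt c := by
    push_cast
    rw [Real.sqrt_div (by positivity), Real.sqrt_mul (by positivity)]
  rw [h2]
  have h3 : (Real.sqrt c : ℂ) ≠ 0 := by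
    have : 0 < Real.sqrt c := by positivity
    exact_mod_cast this.ne'
  have h4 : (Real.sqrt 2 : ℂ) ≠ 0 := by simp
  push_cast
  field_simp

end KD

namespace KD

lemma sum_zmod (c : ℕ) [NeZero c] (f : ZMod c → ℂ) :
    ∑ x : ZMod c, f x = ∑ k ∈ Finset.range c, f (k : ZMod c) := by
  refine Finset.sum_bij' (fun x _ => x.val) (fun k _ => (k : ZMod c)) ?_ ?_ ?_ ?_ ?_
  · intro x _; simpa using ZMod.val_lt x
  · intro k _; simp
  · intro x _; simp
  · intro k hk; exact ZMod.val_natCast_of_lt (by simpa using hk)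
  · intro x _; simp

lemma gs_zmod (b : ℤ) (c : ℕ) [NeZero c] :
    gs b c = ∑ x : ZMod c, ZMod.stdAddChar ((b : ZMod c) * x ^ 2) := by
  rw [sum_zmod, gs]
  refine Finset.sum_congr rfl fun x _ => ?_
  have := ZMod.stdAddChar_coe (N := c) (b * x ^ 2)
  push_cast at this
  rw [this]
  congr 1; ring

lemma gs_congr {b b' : ℤ} {c : ℕ} (hc : 0 < c) (h : (b : ZMod c) = b') : gs b c = gs b' c := by
  have : NeZero c := ⟨hc.ne'⟩
  rw [gs_zmod, gs_zmod, h]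

lemma gs_mul_sq (b : ℤ) (u : ℕ) (c : ℕ) (hc : 0 < c) (hu : Nat.Coprime u c) :
    gs (b * u ^ 2) c = gs b c := by
  have : NeZero c := ⟨hc.ne'⟩
  rw [gs_zmod, gs_zmod]
  refine Fintype.sum_equiv (Units.mulLeft (ZMod.unitOfCoprime u hu)) _ _ fun x => ?_
  congr 1
  simp
  ring

lemma gs_neg (b : ℤ) (c : ℕ) : gs (-b) c = starRingEnd ℂ (gs b c) := by
  rw [gs, gs, map_sum]
  refine Finset.sum_congr rfl fun x _ => ?_
  rw [← Complex.exp_conj]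
  congr 1
  simp
  rw [map_ofNat]

lemma gs_crt (b : ℤ) (m n : ℕ) (hm : 0 < m) (hn : 0 < n) (h : Nat.Coprime m n) :
    gs b (m * n) = gs (b * m) n * gs (b * n) m := by
  have hm' : (m : ℂ) ≠ 0 := by exact_mod_cast hm.ne'
  have hn' : (n : ℂ) ≠ 0 := by exact_mod_cast hn.ne'
  rw [gs, gs, gs, Finset.sum_mul_sum, ← Finset.sum_product']
  symm
  have hinj : Set.InjOn (fun p : ℕ × ℕ => (m * p.1 + n * p.2) % (m * n))
      (Finset.range n ×ˢ Finset.range m : Finset (ℕ × ℕ)) := by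
    rintro ⟨y, z⟩ h1 ⟨y', z'⟩ h2 heq
    simp at h1 h2
    have heq' : m * y + n * z ≡ m * y' + n * z' [MOD m * n] := heq
    have e1 : m * y ≡ m * y' [MOD n] := by
      have := heq'.of_mul_left m
      unfold Nat.ModEq at this ⊢
      simpa using this
    have e2 : n * z ≡ n * z' [MOD m] := by
      have := heq'.of_mul_right n
      unfold Nat.ModEq at this ⊢
      simpa [Nat.add_mod] using this
    have f1 := Nat.ModEq.cancel_left_of_coprime (by simpa [Nat.gcd_comm] using h) e1
    have f2 := Nat.ModEq.cancel_left_of_coprime h e2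
    rw [Nat.ModEq, Nat.mod_eq_of_lt h1.1, Nat.mod_eq_of_lt h2.1] at f1
    rw [Nat.ModEq, Nat.mod_eq_of_lt h1.2, Nat.mod_eq_of_lt h2.2] at f2
    simp [f1, f2]
  have hmaps : Set.MapsTo (fun p : ℕ × ℕ => (m * p.1 + n * p.2) % (m * n))
      (Finset.range n ×ˢ Finset.range m : Finset (ℕ × ℕ)) (Finset.range (m * n)) := by
    intro p _
    simpa using Nat.mod_lt _ (Nat.mul_pos hm hn)
  refine Finset.sum_nbij (fun p : ℕ × ℕ => (m * p.1 + n * p.2) % (m * n)) hmaps hinj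
    (Finset.surjOn_of_injOn_of_card_le _ hmaps hinj (by simp [mul_comm])) ?_
  rintro ⟨y, z⟩ _
  rw [← Complex.exp_add, Complex.exp_eq_exp_iff_exists_int]
  simp only
  have hd := Nat.div_add_mod (m * y + n * z) (m * n)
  set q := (m * y + n * z) / (m * n)
  set r := (m * y + n * z) % (m * n)
  have hd' : (r : ℂ) = m * y + n * z - m * n * q := by
    have : ((m * n * q + r : ℕ) : ℂ) = ((m * y + n * z : ℕ) : ℂ) := by rw [hd]
    push_cast at this
    linear_combination this
  refine ⟨-(b * (2 * y * z + m * n * q ^ 2 - 2 * q * (m * y + n * z))), ?_⟩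
  rw [hd']
  push_cast
  field_simp
  ring

/-- `ε_v` -/
noncomputable def ep (v : ℕ) : ℂ := if v % 4 = 1 then 1 else I

lemma exp_quarter (n : ℕ) : cexp (2 * Real.pi * I * n / 4) = I ^ n := by
  have : (2 * Real.pi * I * n / 4 : ℂ) = n * (Real.pi / 2 * I) := by ring
  rw [this, Complex.exp_nat_mul, Complex.exp_pi_div_two_mul_I]

lemma gs_mod4 (k : ℕ) (hk : k % 2 = 1) : gs k 4 = if k % 4 = 1 then 2 * (1 + I) else 2 * (1 - I) := by
  have h0 : gs k 4 = ∑ x ∈ Finset.range 4, I ^ (k * x ^ 2) := by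
    rw [gs]
    refine Finset.sum_congr rfl fun x _ => ?_
    rw [← exp_quarter]
    congr 1; push_cast; ring
  have h4 : (I ^ k) ^ 4 = 1 := by
    rw [← pow_mul, mul_comm, pow_mul, I_pow_four, one_pow]
  have h9 : (I ^ k) ^ 9 = I ^ k := by
    linear_combination ((I ^ k) ^ 5 + I ^ k) * h4
  rw [h0]
  have hI : I ^ k = I ^ (k % 4) := by
    conv_lhs => rw [← Nat.div_add_mod k 4, pow_add, pow_mul, I_pow_four, one_pow, one_mul]
  simp only [Finset.sum_range_succ, pow_mul, Finset.sum_range_zero]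
  norm_num
  rw [h4, h9, hI]
  split_ifs with h1
  · rw [h1]; ring
  · rw [show k % 4 = 3 by omega, I_pow_three]; ring

lemma recip_odd (c v : ℕ) (hc : c % 2 = 1) (hv : v % 2 = 1) (h : Nat.Coprime c v) :
    (1 - I) * (Real.sqrt c : ℂ) * gs c v =
      (Real.sqrt v : ℂ) * starRingEnd ℂ (gs v c) * (if (v * c) % 4 = 1 then 1 - I else 1 + I) := by
  have h1 := recip c v (by omega) (by omega)
  have hcop : Nat.Coprime 4 c := by
    rw [show 4 = 2 ^ 2 by norm_num]
    exact Nat.Coprime.pow_left 2 ((Nat.coprime_two_left).mpr (Nat.odd_iff.mpr hc))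
  rw [gs_crt _ 4 c (by norm_num) (by omega) hcop] at h1
  have h2 : gs ((v : ℤ) * (4 : ℕ)) c = gs v c := by
    have := gs_mul_sq v 2 c (by omega) ((Nat.coprime_two_left).mpr (Nat.odd_iff.mpr hc))
    rw [← this]; norm_num
  have h3 : gs ((v : ℤ) * c) 4 = gs ((v * c : ℕ) : ℤ) 4 := by push_cast; rfl
  have hvc : (v * c) % 2 = 1 := by rw [Nat.mul_mod, hc, hv]
  rw [h2, h3, gs_mod4 _ hvc, map_mul] at h1
  split_ifs at h1 ⊢ <;> simp only [map_mul, map_add, map_sub, map_one, conj_I, map_ofNat] at h1 <;>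
    linear_combination h1 / 2

theorem gs_eval (v : ℕ) : v % 2 = 1 → ∀ c : ℤ, Int.gcd c v = 1 →
    gs c v = jacobiSym c v * ep v * (Real.sqrt v : ℂ) := by
  induction v using Nat.strong_induction_on with
  | _ v ih =>
  intro hv
  by_cases hv1 : v = 1
  · subst hv1
    intro c _
    simp [gs, ep]
  -- odd natural c smaller than v
  have key : ∀ c : ℕ, c % 2 = 1 → c < v → Nat.Coprime c v →
      gs c v = jacobiSym c v * ep v * (Real.sqrt v : ℂ) := by
    intro c hc hcv hcop
    have h1 := recip_odd c v hc hv hcop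
    rw [ih c hcv hc v (by simpa using hcop.symm)] at h1
    have hs : (Real.sqrt c : ℂ) ≠ 0 := by
      have : 0 < Real.sqrt c := Real.sqrt_pos.mpr (by exact_mod_cast (by omega : 0 < c))
      exact_mod_cast this.ne'
    have hI : (1 - I : ℂ) ≠ 0 := by
      intro h; have := congrArg re h; simp at this
    apply mul_left_cancel₀ (mul_ne_zero hI hs)
    rw [h1]
    simp only [map_mul, conj_ofReal, map_intCast]
    have hvc : (v * c) % 4 = ((v % 4) * (c % 4)) % 4 := Nat.mul_mod _ _ _
    rw [hvc]
    have hv4 : v % 4 = 1 ∨ v % 4 = 3 := by omega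
    have hc4 : c % 4 = 1 ∨ c % 4 = 3 := by omega
    rcases hc4 with hc4 | hc4
    · rw [jacobiSym.quadratic_reciprocity_one_mod_four' (Nat.odd_iff.mpr hv) hc4]
      rcases hv4 with hv4 | hv4 <;> simp [ep, hv4, hc4]
      · ring
      · linear_combination (Real.sqrt v * jacobiSym c v * Real.sqrt c : ℂ) * I_mul_I
    · rcases hv4 with hv4 | hv4
      · rw [jacobiSym.quadratic_reciprocity_one_mod_four hv4 (Nat.odd_iff.mpr hc)]
        simp [ep, hv4, hc4]
        linear_combination (-Real.sqrt v * jacobiSym c v * Real.sqrt c : ℂ) * I_mul_I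
      · rw [jacobiSym.quadratic_reciprocity_three_mod_four hv4 hc4]
        simp [ep, hv4, hc4]
        ring
  have hv0 : 0 < v := by omega
  have : NeZero v := ⟨hv0.ne'⟩
  intro c hc
  have hm0 : 0 ≤ c % v := Int.emod_nonneg _ (by exact_mod_cast hv0.ne')
  have hmv : c % v < v := Int.emod_lt_of_pos _ (by exact_mod_cast hv0)
  obtain ⟨k, hk⟩ := Int.eq_ofNat_of_zero_le hm0
  have hkv : k < v := by omega
  have hgk : Nat.Coprime k v := by
    have : Int.gcd (c % v) v = 1 := by rw [Int.gcd_emod]; exact hc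
    rw [hk] at this
    simpa using this
  have hck : (c : ZMod v) = ((k : ℤ) : ZMod v) := by
    rw [← hk]; simp
  have hj : jacobiSym c v = jacobiSym k v := by
    rw [jacobiSym.mod_left, hk]
  rw [gs_congr hv0 hck, hj]
  by_cases hko : k % 2 = 1
  · exact key k hko hkv hgk
  · have hcop' : Nat.Coprime (v - k) v := by
      rw [Nat.coprime_self_sub_left hkv.le]; exact hgk
    have h2 := key (v - k) (by omega) (by
      have : k ≠ 0 := by rintro rfl; simp at hgk; omega
      omega) hcop'
    have hck' : (((v - k : ℕ) : ℤ) : ZMod v) = ((-k : ℤ) : ZMod v) := by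
      push_cast [hkv.le]; simp
    have hj' : jacobiSym ((v - k : ℕ) : ℤ) v = ZMod.χ₄ v * jacobiSym k v := by
      rw [← jacobiSym.neg _ (Nat.odd_iff.mpr hv), jacobiSym.mod_left, jacobiSym.mod_left (-k)]
      congr 1
      push_cast [hkv.le]
      simp [sub_eq_add_neg]
    rw [gs_congr hv0 hck', gs_neg, hj'] at h2
    have h3 := congrArg (starRingEnd ℂ) h2
    rw [Complex.conj_conj] at h3
    rw [h3]
    simp only [map_mul, conj_ofReal, map_intCast, Int.cast_mul]
    have hv4 : v % 4 = 1 ∨ v % 4 = 3 := by omega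
    rcases hv4 with hv4 | hv4
    · rw [ZMod.χ₄_nat_one_mod_four hv4]; simp [ep, hv4]
    · rw [ZMod.χ₄_nat_three_mod_four hv4]; simp [ep, hv4]

/-- The multiplier in the Kloosterman sum is a quadratic Gauss sum. -/
theorem mult_eq (c v : ℕ) (hc : 0 < c) (hv : v % 2 = 1) (h : Nat.Coprime c v) :
    (1 - I) * (jacobiSym c v * ep v) * (2 * (Real.sqrt c : ℂ)) = starRingEnd ℂ (gs v (4 * c)) := by
  have h1 := recip c v hc (by omega)
  rw [gs_eval v hv c (by simpa using h)] at h1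
  have hs : (Real.sqrt v : ℂ) ≠ 0 := by
    have : 0 < Real.sqrt v := Real.sqrt_pos.mpr (by exact_mod_cast (by omega : 0 < v))
    exact_mod_cast this.ne'
  apply mul_left_cancel₀ hs
  rw [← h1]; ring

end KD

namespace KD

/-- number of square roots of `d` mod `q` -/
noncomputable def Nsol (d : ℤ) (q : ℕ) : ℕ := Nat.card {x : ZMod q // x ^ 2 = (d : ZMod q)}

/-- normalized average of Ramanujan sums -/
noncomputable def Fs (d : ℤ) (q : ℕ) : ℂ :=
  (∑ v ∈ (Finset.range q).filter (fun v => Nat.Coprime v q), ∑ x ∈ Finset.range q,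
    cexp (2 * Real.pi * I * (v * (d - x ^ 2)) / q)) / q

lemma sum_units (q : ℕ) [NeZero q] (f : ZMod q → ℂ) :
    ∑ v ∈ (Finset.range q).filter (fun v => Nat.Coprime v q), f v = ∑ u : (ZMod q)ˣ, f u := by
  symm
  refine Finset.sum_bij (fun u _ => (u : ZMod q).val) ?_ ?_ ?_ ?_
  · intro u _
    simp only [Finset.mem_filter, Finset.mem_range]
    exact ⟨ZMod.val_lt _, ZMod.val_coe_unit_coprime u⟩
  · intro u _ u' _ h
    exact Units.ext (ZMod.val_injective q h)
  · intro v hv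
    simp only [Finset.mem_filter, Finset.mem_range] at hv
    refine ⟨ZMod.unitOfCoprime v hv.2, Finset.mem_univ _, ?_⟩
    rw [ZMod.coe_unitOfCoprime]
    exact ZMod.val_natCast_of_lt hv.1
  · intro u _
    simp

lemma Fs_units (d : ℤ) (q : ℕ) [NeZero q] :
    (q : ℂ) * Fs d q = ∑ u : (ZMod q)ˣ, ∑ x : ZMod q, ZMod.stdAddChar ((u : ZMod q) * ((d : ZMod q) - x ^ 2)) := by
  have hq : (q : ℂ) ≠ 0 := by exact_mod_cast NeZero.ne q
  rw [Fs, mul_div_cancel₀ _ hq, ← sum_units q (fun y => ∑ x : ZMod q, ZMod.stdAddChar (y * ((d : ZMod q) - x ^ 2)))]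
  refine Finset.sum_congr rfl fun v _ => ?_
  rw [sum_zmod]
  refine Finset.sum_congr rfl fun x _ => ?_
  have := ZMod.stdAddChar_coe (N := q) (v * (d - x ^ 2))
  push_cast at this
  rw [this]

lemma kron_eq (c v : ℕ) (hv : v % 2 = 1) : kronecker ((4 * c : ℕ) : ℤ) v = jacobiSym c v := by
  have h0 : v ≠ 0 := by rintro rfl; simp at hv
  have hf : v.factorization 2 = 0 := Nat.factorization_eq_zero_of_not_dvd (by omega)
  unfold kronecker
  simp only [Int.natAbs_natCast, hf]
  have h4 : jacobiSym ((4 * c : ℕ) : ℤ) v = jacobiSym c v := by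
    push_cast
    rw [jacobiSym.mul_left, jacobiSym.at_four (Nat.odd_iff.mpr hv), one_mul]
  have hneg : ¬ ((v : ℤ) < 0 ∧ ((4 * c : ℕ) : ℤ) < 0) := by omega
  have he : ((4 * c : ℕ) : ℤ) % 2 = 0 := by omega
  simp only [hneg, he, if_true, if_false, pow_zero, Nat.div_one, one_mul, h4]
  simp [h0]

theorem Kplus_eq (d : ℤ) (c : ℕ) (hc : 0 < c) :
    2 * (Real.sqrt c : ℂ) * Kplus d 0 (4 * c) =
      (if c % 2 = 1 then 2 else 1) * (4 * c * Fs d (4 * c)) := by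
  have : NeZero (4 * c) := ⟨by omega⟩
  have hq := Fs_units d (4 * c)
  push_cast at hq
  rw [hq, Kplus, show 4 * c / 4 = c by omega]
  rw [← Finset.sum_filter]
  have h1 : ∀ v ∈ (Finset.range (4 * c)).filter (fun v => Nat.gcd v (4 * c) = 1),
      2 * (Real.sqrt c : ℂ) * (1 - I) * ((kronecker ((4 * c : ℕ) : ℤ) v : ℂ) * (if v % 4 = 1 then 1 else I) *
        eexp ((d * ((((v : ZMod (4 * c))⁻¹).val : ℕ) : ℂ) + (0 : ℤ) * v) / (4 * c : ℕ))) =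
      (fun y : ZMod (4 * c) => (∑ x : ZMod (4 * c), ZMod.stdAddChar (-y * x ^ 2)) *
        ZMod.stdAddChar ((d : ZMod (4 * c)) * y⁻¹)) v := by
    intro v hv
    simp only [Finset.mem_filter, Finset.mem_range] at hv
    have hv2 : v % 2 = 1 := by
      by_contra h
      have h2 : 2 ∣ Nat.gcd v (4 * c) := Nat.dvd_gcd (by omega) (by omega)
      rw [hv.2] at h2; omega
    have hcop : Nat.Coprime c v := (Nat.Coprime.coprime_mul_left_right (show Nat.Coprime v (4 * c) from hv.2)).symm
    have hm := mult_eq c v hc hv2 hcop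
    rw [kron_eq c v hv2]
    rw [← gs_neg, gs_zmod] at hm
    have he : eexp ((d * ((((v : ZMod (4 * c))⁻¹).val : ℕ) : ℂ) + (0 : ℤ) * v) / (4 * c : ℕ)) =
        ZMod.stdAddChar ((d : ZMod (4 * c)) * (v : ZMod (4 * c))⁻¹) := by
      have := ZMod.stdAddChar_coe (N := 4 * c) (d * ((v : ZMod (4 * c))⁻¹).val)
      have h7 : ((d * (((v : ZMod (4 * c))⁻¹).val : ℕ) : ℤ) : ZMod (4 * c)) = (d : ZMod (4 * c)) * (v : ZMod (4 * c))⁻¹ := by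
        rw [Int.cast_mul, Int.cast_natCast, ZMod.natCast_zmod_val]
      rw [h7] at this
      rw [this, eexp]
      congr 1
      simp
      ring
    rw [he]
    simp only [Int.cast_neg, Int.cast_natCast] at hm
    simp only
    rw [← hm, ep]
    ring
  have h2 : ∀ m : ℂ, 2 * (Real.sqrt c : ℂ) * ((1 - I) * m *
     ∑ v ∈ (Finset.range (4 * c)).filter (fun v => Nat.gcd v (4 * c) = 1),
      ((kronecker ((4 * c : ℕ) : ℤ) v : ℂ) * (if v % 4 = 1 then 1 else I) *
        eexp ((d * ((((v : ZMod (4 * c))⁻¹).val : ℕ) : ℂ) + (0 : ℤ) * v) / (4 * c : ℕ)))) =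
      m * ∑ v ∈ (Finset.range (4 * c)).filter (fun v => Nat.gcd v (4 * c) = 1),
        (fun y : ZMod (4 * c) => (∑ x : ZMod (4 * c), ZMod.stdAddChar (-y * x ^ 2)) *
        ZMod.stdAddChar ((d : ZMod (4 * c)) * y⁻¹)) v := by
    intro m
    rw [← Finset.sum_congr rfl h1, ← Finset.mul_sum]
    ring
  rw [h2]
  congr 1
  have h3 := sum_units (4 * c) (fun y : ZMod (4 * c) => (∑ x : ZMod (4 * c), ZMod.stdAddChar (-y * x ^ 2)) *
        ZMod.stdAddChar ((d : ZMod (4 * c)) * y⁻¹))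
  unfold Nat.Coprime at h3
  rw [h3]
  refine Fintype.sum_equiv (Equiv.inv _) _ _ fun u => ?_
  simp only [Finset.sum_mul]
  refine Fintype.sum_equiv (Units.mulLeft u) _ _ fun x => ?_
  rw [← AddChar.map_add_eq_mul]
  congr 1
  simp only [Units.mulLeft_apply, Equiv.inv_apply, ZMod.inv_coe_unit]
  have hu : (u : ZMod (4 * c)) * ((u⁻¹ : (ZMod (4 * c))ˣ) : ZMod (4 * c)) = 1 := by simp
  linear_combination (u * x ^ 2 : ZMod (4 * c)) * hu

lemma sum_periodic (g k : ℕ) (f : ℕ → ℂ) (hf : ∀ x j, f (g * j + x) = f x) :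
    ∑ x ∈ Finset.range (g * k), f x = k * ∑ x ∈ Finset.range g, f x := by
  induction k with
  | zero => simp
  | succ k ih =>
    rw [Nat.mul_succ, Finset.sum_range_add, ih]
    simp only [hf]
    push_cast; ring

lemma sum_divisors_reindex (q : ℕ) (hq : 0 < q) (f : ℕ → ℕ → ℂ) (h : ℕ → ℂ)
    (hfh : ∀ g k v, q = g * k → f g v = h (v * k)) :
    ∑ g ∈ q.divisors, ∑ v ∈ (Finset.range g).filter (fun v => Nat.Coprime v g), f g v =
      ∑ t ∈ Finset.range q, h t := by
  rw [Finset.sum_sigma']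
  refine Finset.sum_bij' (fun p _ => p.2 * (q / p.1)) (fun t _ => ⟨q / Nat.gcd t q, t / Nat.gcd t q⟩) ?_ ?_ ?_ ?_ ?_
  · rintro ⟨g, v⟩ hp
    simp only [Finset.mem_sigma, Nat.mem_divisors, Finset.mem_filter, Finset.mem_range] at hp ⊢
    obtain ⟨⟨⟨k, rfl⟩, _⟩, hv, _⟩ := hp
    have hg : 0 < g := by omega
    rw [Nat.mul_div_cancel_left _ hg]
    exact Nat.mul_lt_mul_of_pos_right hv (Nat.pos_of_mul_pos_left hq |> fun h => by
      rcases Nat.eq_zero_or_pos k with h | h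
      · simp [h] at hq
      · exact h)
  · intro t ht
    simp only [Finset.mem_sigma, Nat.mem_divisors, Finset.mem_filter, Finset.mem_range] at ht ⊢
    have hg : 0 < Nat.gcd t q := Nat.gcd_pos_of_pos_right _ hq
    refine ⟨⟨Nat.div_dvd_of_dvd (Nat.gcd_dvd_right _ _), hq.ne'⟩, ?_, Nat.coprime_div_gcd_div_gcd hg⟩
    exact Nat.div_lt_div_of_lt_of_dvd (Nat.gcd_dvd_right _ _) ht
  · rintro ⟨g, v⟩ hp
    simp only [Finset.mem_sigma, Nat.mem_divisors, Finset.mem_filter, Finset.mem_range] at hp ⊢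
    obtain ⟨⟨⟨k, rfl⟩, _⟩, hv, hc⟩ := hp
    have hg : 0 < g := by omega
    have hk : 0 < k := by
      rcases Nat.eq_zero_or_pos k with h | h
      · simp [h] at hq
      · exact h
    rw [Nat.mul_div_cancel_left _ hg, Nat.gcd_mul_right, hc, one_mul, Nat.mul_div_cancel _ hk,
      Nat.mul_div_cancel _ hk]
  · intro t ht
    have hg : 0 < Nat.gcd t q := Nat.gcd_pos_of_pos_right _ hq
    simp only
    rw [Nat.div_div_self (Nat.gcd_dvd_right _ _) hq.ne']
    exact Nat.div_mul_cancel (Nat.gcd_dvd_left _ _)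
  · rintro ⟨g, v⟩ hp
    simp only [Finset.mem_sigma, Nat.mem_divisors, Finset.mem_filter, Finset.mem_range] at hp ⊢
    exact hfh _ _ _ (Nat.mul_div_cancel' hp.1.1).symm

theorem sum_Fs (d : ℤ) (q : ℕ) (hq : 0 < q) : ∑ g ∈ q.divisors, Fs d g = Nsol d q := by
  have : NeZero q := ⟨hq.ne'⟩
  have hq' : (q : ℂ) ≠ 0 := by exact_mod_cast hq.ne'
  have h1 : ∀ g ∈ q.divisors, (q : ℂ) * Fs d g =
      ∑ v ∈ (Finset.range g).filter (fun v => Nat.Coprime v g), ∑ x ∈ Finset.range q,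
        cexp (2 * Real.pi * I * (v * (d - x ^ 2)) / g) := by
    intro g hg
    obtain ⟨k, hk⟩ := (Nat.mem_divisors.mp hg).1
    have hg0 : (g : ℂ) ≠ 0 := by
      have : g ≠ 0 := by rintro rfl; simp at hk; omega
      exact_mod_cast this
    rw [Fs, hk]
    have : ((g * k : ℕ) : ℂ) * ((∑ v ∈ (Finset.range g).filter (fun v => Nat.Coprime v g), ∑ x ∈ Finset.range g,
    cexp (2 * Real.pi * I * (v * (d - x ^ 2)) / g)) / g) = k * (∑ v ∈ (Finset.range g).filter (fun v => Nat.Coprime v g), ∑ x ∈ Finset.range g,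
    cexp (2 * Real.pi * I * (v * (d - x ^ 2)) / g)) := by
      push_cast; field_simp
    rw [this, Finset.mul_sum]
    refine Finset.sum_congr rfl fun v _ => ?_
    rw [sum_periodic g k (fun x => cexp (2 * Real.pi * I * (v * (d - x ^ 2)) / g))]
    intro x j
    rw [Complex.exp_eq_exp_iff_exists_int]
    refine ⟨-(v * (g * j ^ 2 + 2 * j * x)), ?_⟩
    push_cast
    field_simp
    ring
  apply mul_left_cancel₀ hq'
  rw [Finset.mul_sum, Finset.sum_congr rfl h1]
  rw [sum_divisors_reindex q hq _ (fun t => ∑ x ∈ Finset.range q, cexp (2 * Real.pi * I * (t * (d - x ^ 2)) / q))]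
  · rw [Finset.sum_comm]
    have h2 : ∀ x ∈ Finset.range q, ∑ t ∈ Finset.range q, cexp (2 * Real.pi * I * (t * (d - x ^ 2)) / q) =
        (fun y : ZMod q => if y ^ 2 = (d : ZMod q) then (q : ℂ) else 0) x := by
      intro x _
      have h3 := sum_zmod q (fun t => ZMod.stdAddChar (t * ((d : ZMod q) - (x : ZMod q) ^ 2)))
      have h4 := AddChar.sum_mulShift ((d : ZMod q) - (x : ZMod q) ^ 2) (ZMod.isPrimitive_stdAddChar q)
      rw [h3, ZMod.card] at h4
      have h5 : ∀ t ∈ Finset.range q, cexp (2 * Real.pi * I * (t * (d - x ^ 2)) / q) =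
          ZMod.stdAddChar ((t : ZMod q) * ((d : ZMod q) - (x : ZMod q) ^ 2)) := by
        intro t _
        have := ZMod.stdAddChar_coe (N := q) (t * (d - x ^ 2))
        push_cast at this
        rw [this]
      rw [Finset.sum_congr rfl h5, h4]
      simp only [sub_eq_zero]
      by_cases h : (d : ZMod q) = (x : ZMod q) ^ 2
      · simp [h]
      · simp [h, Ne.symm h]
    rw [Finset.sum_congr rfl h2, ← sum_zmod q (fun y : ZMod q => if y ^ 2 = (d : ZMod q) then (q : ℂ) else 0), ← Finset.sum_filter, Finset.sum_const, Nsol,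
      Nat.card_eq_fintype_card, Fintype.card_subtype, nsmul_eq_mul, mul_comm]
  · intro g k v hgk
    refine Finset.sum_congr rfl fun x _ => ?_
    have hgk' : (q : ℂ) = g * k := by exact_mod_cast hgk
    have hg0 : (g : ℂ) ≠ 0 := by rintro h; simp [h] at hgk'; omega
    have hk0 : (k : ℂ) ≠ 0 := by rintro h; simp [h] at hgk'; omega
    rw [hgk']
    congr 1
    push_cast
    field_simp

end KD

namespace KD

lemma Nsol_mul (d : ℤ) (m n : ℕ) (h : Nat.Coprime m n) : Nsol d (m * n) = Nsol d m * Nsol d n := by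
  unfold Nsol
  rw [← Nat.card_prod]
  let e := ZMod.chineseRemainder h
  refine Nat.card_congr ?_
  refine (Equiv.subtypeEquiv (q := fun p : ZMod m × ZMod n => p.1 ^ 2 = (d : ZMod m) ∧ p.2 ^ 2 = (d : ZMod n)) e.toEquiv ?_).trans
    (Equiv.subtypeProdEquivProd (p := fun x : ZMod m => x ^ 2 = (d : ZMod m)) (q := fun x : ZMod n => x ^ 2 = (d : ZMod n)))
  intro x
  rw [← e.injective.eq_iff, map_pow, map_intCast, Prod.ext_iff]
  simp

lemma Nsol_eq_card (d : ℤ) (q : ℕ) [NeZero q] :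
    Nsol d q = (Finset.univ.filter (fun x : ZMod q => x ^ 2 = (d : ZMod q))).card := by
  rw [Nsol, Nat.card_eq_fintype_card, Fintype.card_subtype]

lemma Nsol_zero (d : ℤ) (q : ℕ) [NeZero q] (h : ∀ y : ℤ, ¬ (q : ℤ) ∣ y ^ 2 - d) : Nsol d q = 0 := by
  rw [Nsol_eq_card, Finset.card_eq_zero, Finset.filter_eq_empty_iff]
  intro x _ hx
  apply h x.val
  rw [← ZMod.intCast_zmod_eq_zero_iff_dvd]
  push_cast
  rw [ZMod.natCast_zmod_val, hx, sub_self]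

lemma Nsol_one (d : ℤ) : Nsol d 1 = 1 := by
  rw [Nsol_eq_card, Finset.filter_true_of_mem (fun x _ => Subsingleton.elim _ _)]
  rfl

/-- existence of square root mod q -/
def Rt (d : ℤ) (q : ℕ) : Prop := ∃ y : ℤ, (q : ℤ) ∣ y ^ 2 - d

lemma Rt_mono {d : ℤ} {q q' : ℕ} (h : q ∣ q') (hr : Rt d q') : Rt d q := by
  obtain ⟨y, hy⟩ := hr
  exact ⟨y, (Int.natCast_dvd_natCast.mpr h).trans hy⟩

lemma Nsol_zero' {d : ℤ} {q : ℕ} (hq : 0 < q) (h : ¬ Rt d q) : Nsol d q = 0 := by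
  have : NeZero q := ⟨hq.ne'⟩
  exact Nsol_zero d q (fun y hy => h ⟨y, hy⟩)

lemma lift_odd {p : ℕ} (hp : p.Prime) (hp2 : p ≠ 2) {d : ℤ} (hd : ¬ (p : ℤ) ∣ d) (h : Rt d p) (k : ℕ) :
    Rt d (p ^ (k + 1)) := by
  have hpi : Prime (p : ℤ) := Nat.prime_iff_prime_int.mp hp
  induction k with
  | zero => simpa using h
  | succ k ih =>
    obtain ⟨y, m, hm⟩ := ih
    have hy : ¬ (p : ℤ) ∣ 2 * y := by
      intro hdv
      rcases hpi.dvd_or_dvd hdv with h2 | h2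
      · have : p ∣ 2 := by exact_mod_cast h2
        exact hp2 ((Nat.prime_dvd_prime_iff_eq hp Nat.prime_two).mp this)
      · apply hd
        have h3 : (p : ℤ) ∣ y ^ 2 := dvd_pow h2 two_ne_zero
        have h4 : (p : ℤ) ∣ y ^ 2 - d := by
          rw [hm]; push_cast; exact ⟨(p:ℤ) ^ k * m, by ring⟩
        simpa using dvd_sub h3 h4
    obtain ⟨a, b, hab⟩ := (hpi.coprime_iff_not_dvd.mpr hy)
    -- a*p + b*(2y) = 1
    refine ⟨y - m * b * p ^ (k + 1), ?_⟩
    have : (y - m * b * p ^ (k + 1)) ^ 2 - d = (p:ℤ) ^ (k + 1 + 1) * (m * a + m ^ 2 * b ^ 2 * p ^ k) := by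
      push_cast at hm
      have e1 : (p:ℤ) ^ (k + 1 + 1) = p ^ (k + 1) * p := pow_succ _ _
      have e2 : (p:ℤ) ^ (k + 1) = p ^ k * p := pow_succ _ _
      rw [e1]
      rw [e2] at hm ⊢
      linear_combination hm - (m * p ^ k * p) * hab
    rw [this]
    push_cast
    exact Dvd.intro _ rfl

lemma count_odd {p : ℕ} (hp : p.Prime) (hp2 : p ≠ 2) {d : ℤ} (hd : ¬ (p : ℤ) ∣ d) (k : ℕ)
    (h : Rt d (p ^ (k + 1))) : Nsol d (p ^ (k + 1)) = 2 := by
  have hpi : Prime (p : ℤ) := Nat.prime_iff_prime_int.mp hp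
  have : NeZero (p ^ (k + 1)) := ⟨(pow_pos hp.pos _).ne'⟩
  obtain ⟨y, hy⟩ := h
  have hpd : (p : ℤ) ∣ y ^ 2 - d := dvd_trans (by push_cast; exact dvd_pow_self _ (by omega)) hy
  have hy2 : ¬ (p : ℤ) ∣ 2 * y := by
    intro hdv
    rcases hpi.dvd_or_dvd hdv with h2 | h2
    · have : p ∣ 2 := by exact_mod_cast h2
      exact hp2 ((Nat.prime_dvd_prime_iff_eq hp Nat.prime_two).mp this)
    · apply hd
      have h3 : (p : ℤ) ∣ y ^ 2 := dvd_pow h2 two_ne_zero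
      simpa using dvd_sub h3 hpd
  have hyd : (d : ZMod (p ^ (k + 1))) = (y : ZMod (p ^ (k + 1))) ^ 2 := by
    have := (ZMod.intCast_zmod_eq_zero_iff_dvd (y ^ 2 - d) (p ^ (k + 1))).mpr hy
    push_cast at this
    exact (sub_eq_zero.mp this).symm
  have hset : Finset.univ.filter (fun x : ZMod (p ^ (k + 1)) => x ^ 2 = (d : ZMod (p ^ (k + 1)))) =
      {(y : ZMod (p ^ (k + 1))), -(y : ZMod (p ^ (k + 1)))} := by
    ext x
    simp only [Finset.mem_filter, Finset.mem_univ, true_and, Finset.mem_insert, Finset.mem_singleton]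
    constructor
    · intro hx
      obtain ⟨z, rfl⟩ := ZMod.intCast_surjective x
      have hz : ((p ^ (k + 1) : ℕ) : ℤ) ∣ (z - y) * (z + y) := by
        rw [← ZMod.intCast_zmod_eq_zero_iff_dvd]
        push_cast
        rw [hyd] at hx
        linear_combination hx
      push_cast at hz
      by_cases hc : (p : ℤ) ∣ z - y
      · have hnc : ¬ (p : ℤ) ∣ z + y := by
          intro h; apply hy2; have := dvd_sub h hc; ring_nf at this ⊢; exact this
        left
        have hcop : IsCoprime ((p : ℤ) ^ (k + 1)) (z + y) :=
          IsCoprime.pow_left (hpi.coprime_iff_not_dvd.mpr hnc)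
        have := hcop.dvd_of_dvd_mul_right hz
        have h3 := (ZMod.intCast_zmod_eq_zero_iff_dvd (z - y) (p ^ (k + 1))).mpr (by push_cast; exact this)
        push_cast at h3
        exact sub_eq_zero.mp h3
      · right
        have hcop : IsCoprime ((p : ℤ) ^ (k + 1)) (z - y) :=
          IsCoprime.pow_left (hpi.coprime_iff_not_dvd.mpr hc)
        have := hcop.dvd_of_dvd_mul_left hz
        have h3 := (ZMod.intCast_zmod_eq_zero_iff_dvd (z + y) (p ^ (k + 1))).mpr (by push_cast; exact this)
        push_cast at h3
        exact eq_neg_of_add_eq_zero_left h3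
    · rintro (rfl | rfl)
      · exact hyd.symm
      · rw [neg_sq]; exact hyd.symm
  rw [Nsol_eq_card, hset, Finset.card_pair]
  intro h
  apply hy2
  have h1 : ((2 * y : ℤ) : ZMod (p ^ (k + 1))) = 0 := by
    push_cast; linear_combination h
  have := (ZMod.intCast_zmod_eq_zero_iff_dvd _ _).mp h1
  exact dvd_trans (by push_cast; exact dvd_pow_self _ (by omega)) this

lemma Nsol_odd_const {p : ℕ} (hp : p.Prime) (hp2 : p ≠ 2) {d : ℤ} (hd : ¬ (p : ℤ) ∣ d) (k : ℕ) :
    Nsol d (p ^ (k + 1)) = Nsol d p := by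
  by_cases h : Rt d p
  · rw [count_odd hp hp2 hd k (lift_odd hp hp2 hd h k)]
    have := count_odd hp hp2 hd 0 (by simpa using h)
    simpa using this.symm
  · rw [Nsol_zero' hp.pos h, Nsol_zero' (pow_pos hp.pos _)]
    exact fun hr => h (Rt_mono (dvd_pow_self _ (by omega)) hr)

lemma Nsol_prime {p : ℕ} (hp : p.Prime) (hp2 : p ≠ 2) (d : ℤ) :
    (Nsol d p : ℤ) = jacobiSym d p + 1 := by
  have : Fact p.Prime := ⟨hp⟩
  rw [← jacobiSym.legendreSym.to_jacobiSym, ← legendreSym.card_sqrts p hp2 d, Nsol_eq_card]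
  congr 2
  ext x; simp

lemma Nsol_sq {p : ℕ} (hp : p.Prime) {d : ℤ} (hd : (p : ℤ) ∣ d) (hd2 : ¬ (p : ℤ) ^ 2 ∣ d) (k : ℕ) :
    Nsol d (p ^ (k + 2)) = 0 := by
  apply Nsol_zero' (pow_pos hp.pos _)
  intro hr
  obtain ⟨y, hy⟩ := Rt_mono (pow_dvd_pow p (show 2 ≤ k + 2 by omega)) hr
  push_cast at hy
  have hpi : Prime (p : ℤ) := Nat.prime_iff_prime_int.mp hp
  have h1 : (p : ℤ) ∣ y ^ 2 - d := dvd_trans (dvd_pow_self _ two_ne_zero) hy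
  have h2 : (p : ℤ) ∣ y ^ 2 := by simpa using dvd_add h1 hd
  have h3 := hpi.dvd_of_dvd_pow h2
  apply hd2
  simpa using dvd_sub (pow_dvd_pow_of_dvd h3 2) hy

lemma lift_two {d : ℤ} (hd : d % 8 = 1) (k : ℕ) : Rt d (2 ^ (k + 3)) := by
  induction k with
  | zero => exact ⟨1, by norm_num; omega⟩
  | succ k ih =>
    obtain ⟨y, m, hm⟩ := ih
    have hm' : y ^ 2 - d = 8 * 2 ^ k * m := by rw [hm]; push_cast; ring
    have hyo : y % 2 = 1 := by
      rcases Int.emod_two_eq_zero_or_one y with h | h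
      · exfalso
        obtain ⟨z, rfl⟩ : ∃ z, y = 2 * z := ⟨y / 2, by omega⟩
        have : d = 2 * (2 * z ^ 2 - 4 * (2 ^ k * m)) := by linear_combination -hm'
        omega
      · exact h
    obtain ⟨z, rfl⟩ : ∃ z, y = 2 * z + 1 := ⟨y / 2, by omega⟩
    rcases Int.emod_two_eq_zero_or_one m with h | h
    · obtain ⟨n, rfl⟩ : ∃ n, m = 2 * n := ⟨m / 2, by omega⟩
      refine ⟨2 * z + 1, n, ?_⟩
      rw [hm']; push_cast; ring
    · obtain ⟨n, rfl⟩ : ∃ n, m = 2 * n + 1 := ⟨m / 2, by omega⟩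
      refine ⟨2 * z + 1 + 4 * 2 ^ k, n + 1 + z + 2 ^ k, ?_⟩
      push_cast
      linear_combination hm'

lemma count_two {d : ℤ} (hd : d % 8 = 1) (k : ℕ) : Nsol d (2 ^ (k + 3)) = 4 := by
  obtain ⟨y, hy⟩ := lift_two hd k
  have hyo : ∃ z, y = 2 * z + 1 := by
    obtain ⟨m, hm⟩ := hy
    have hm' : y ^ 2 - d = 8 * 2 ^ k * m := by rw [hm]; push_cast; ring
    rcases Int.emod_two_eq_zero_or_one y with h | h
    · exfalso
      obtain ⟨z, rfl⟩ : ∃ z, y = 2 * z := ⟨y / 2, by omega⟩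
      have : d = 2 * (2 * z ^ 2 - 4 * (2 ^ k * m)) := by linear_combination -hm'
      omega
    · exact ⟨y / 2, by omega⟩
  obtain ⟨z, hz⟩ := hyo
  set q := 2 ^ (k + 3) with hq
  have hq8 : (q : ℤ) = 8 * 2 ^ k := by rw [hq]; push_cast; ring
  have : NeZero q := ⟨by positivity⟩
  have hyd : (d : ZMod q) = (y : ZMod q) ^ 2 := by
    have := (ZMod.intCast_zmod_eq_zero_iff_dvd (y ^ 2 - d) q).mpr hy
    push_cast at this
    exact (sub_eq_zero.mp this).symm
  have key : ∀ a b : ℤ, (a : ZMod q) = (b : ZMod q) ↔ (8 * 2 ^ k : ℤ) ∣ a - b := by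
    intro a b
    rw [← hq8, ← ZMod.intCast_zmod_eq_zero_iff_dvd]
    push_cast
    exact sub_eq_zero.symm
  have hset : Finset.univ.filter (fun x : ZMod q => x ^ 2 = (d : ZMod q)) =
      {(y : ZMod q), ((-y : ℤ) : ZMod q), ((y + 4 * 2 ^ k : ℤ) : ZMod q), ((-y + 4 * 2 ^ k : ℤ) : ZMod q)} := by
    ext x
    simp only [Finset.mem_filter, Finset.mem_univ, true_and, Finset.mem_insert, Finset.mem_singleton]
    obtain ⟨w, rfl⟩ := ZMod.intCast_surjective x
    have e1 : ((w : ZMod q) ^ 2 = (d : ZMod q)) ↔ (8 * 2 ^ k : ℤ) ∣ w ^ 2 - y ^ 2 := by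
      rw [hyd, ← key]; push_cast; rfl
    rw [e1, key, key, key, key]
    constructor
    · rintro ⟨m, hm⟩
      have hwo : ∃ v, w = 2 * v + 1 := by
        rcases Int.emod_two_eq_zero_or_one w with h | h
        · exfalso
          obtain ⟨v, rfl⟩ : ∃ v, w = 2 * v := ⟨w / 2, by omega⟩
          have : 2 * (2 * v ^ 2 - 2 * z ^ 2 - 2 * z - 4 * (2 ^ k * m)) = 1 := by
            rw [hz] at hm; linear_combination hm
          omega
        · exact ⟨w / 2, by omega⟩
      obtain ⟨v, hv⟩ := hwo
      have h2 : (2 * 2 ^ k : ℤ) ∣ (v - z) * (v + z + 1) := by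
        refine ⟨m, ?_⟩
        rw [hz, hv] at hm
        have h4 : 4 * ((v - z) * (v + z + 1)) = 4 * (2 * 2 ^ k * m) := by linear_combination hm
        linarith
      have h2' : ((2 : ℤ) ^ (k + 1)) ∣ (v - z) * (v + z + 1) := by
        rw [pow_succ, mul_comm]; exact h2
      rcases Int.emod_two_eq_zero_or_one (v - z) with h | h
      · have hcop : IsCoprime ((2 : ℤ) ^ (k + 1)) (v + z + 1) :=
          IsCoprime.pow_left (Int.prime_two.coprime_iff_not_dvd.mpr (by omega))
        obtain ⟨n, hn⟩ := hcop.dvd_of_dvd_mul_right h2'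
        have hn' : v - z = 2 * 2 ^ k * n := by rw [hn]; ring
        rcases Int.emod_two_eq_zero_or_one n with h | h
        · obtain ⟨j, rfl⟩ : ∃ j, n = 2 * j := ⟨n / 2, by omega⟩
          left; exact ⟨j, by rw [hv, hz]; linear_combination 2 * hn'⟩
        · obtain ⟨j, rfl⟩ : ∃ j, n = 2 * j + 1 := ⟨n / 2, by omega⟩
          right; right; left; exact ⟨j, by rw [hv, hz]; linear_combination 2 * hn'⟩
      · have hcop : IsCoprime ((2 : ℤ) ^ (k + 1)) (v - z) :=
          IsCoprime.pow_left (Int.prime_two.coprime_iff_not_dvd.mpr (by omega))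
        obtain ⟨n, hn⟩ := hcop.dvd_of_dvd_mul_left h2'
        have hn' : v + z + 1 = 2 * 2 ^ k * n := by rw [hn]; ring
        rcases Int.emod_two_eq_zero_or_one n with h | h
        · obtain ⟨j, rfl⟩ : ∃ j, n = 2 * j := ⟨n / 2, by omega⟩
          right; left; exact ⟨j, by rw [hv, hz]; linear_combination 2 * hn'⟩
        · obtain ⟨j, rfl⟩ : ∃ j, n = 2 * j + 1 := ⟨n / 2, by omega⟩
          right; right; right; exact ⟨j, by rw [hv, hz]; linear_combination 2 * hn'⟩
    · rintro (⟨n, hn⟩ | ⟨n, hn⟩ | ⟨n, hn⟩ | ⟨n, hn⟩)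
      · exact ⟨n * (w + y), by linear_combination (w + y) * hn⟩
      · exact ⟨n * (w - y), by linear_combination (w - y) * hn⟩
      · exact ⟨n * (w + y) + (y + 2 * 2 ^ k + 4 * 2 ^ k * n), by
          linear_combination (w + y + 4 * 2 ^ k) * hn⟩
      · exact ⟨n * (w - y) + (-y + 2 * 2 ^ k + 4 * 2 ^ k * n), by
          linear_combination (w - y + 4 * 2 ^ k) * hn⟩
  rw [Nsol_eq_card, hset]
  have hp : (0:ℤ) < 2 ^ k := by positivity
  have n12 : (y : ZMod q) ≠ ((-y : ℤ) : ZMod q) := by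
    rw [Ne, key]; rintro ⟨n, hn⟩
    have : 2 * (2 * (2 ^ k * n)) - 2 * z = 1 := by rw [hz] at hn; linarith
    omega
  have n13 : (y : ZMod q) ≠ ((y + 4 * 2 ^ k : ℤ) : ZMod q) := by
    rw [Ne, key]; rintro ⟨n, hn⟩
    have : (2 ^ k : ℤ) * (2 * n + 1) = 0 := by linarith
    rcases mul_eq_zero.mp this with h | h <;> omega
  have n14 : (y : ZMod q) ≠ ((-y + 4 * 2 ^ k : ℤ) : ZMod q) := by
    rw [Ne, key]; rintro ⟨n, hn⟩
    have : 2 * (2 * (2 ^ k * n) + 2 ^ k) - 2 * z = 1 := by rw [hz] at hn; linarith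
    omega
  have n23 : ((-y : ℤ) : ZMod q) ≠ ((y + 4 * 2 ^ k : ℤ) : ZMod q) := by
    rw [Ne, key]; rintro ⟨n, hn⟩
    have : 2 * (-2 * (2 ^ k * n) - 2 ^ k) - 2 * z = 1 := by rw [hz] at hn; linarith
    omega
  have n24 : ((-y : ℤ) : ZMod q) ≠ ((-y + 4 * 2 ^ k : ℤ) : ZMod q) := by
    rw [Ne, key]; rintro ⟨n, hn⟩
    have : (2 ^ k : ℤ) * (2 * n + 1) = 0 := by linarith
    rcases mul_eq_zero.mp this with h | h <;> omega
  have n34 : ((y + 4 * 2 ^ k : ℤ) : ZMod q) ≠ ((-y + 4 * 2 ^ k : ℤ) : ZMod q) := by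
    rw [Ne, key]; rintro ⟨n, hn⟩
    have : 2 * (2 * (2 ^ k * n)) - 2 * z = 1 := by rw [hz] at hn; linarith
    omega
  rw [Finset.card_insert_of_notMem, Finset.card_insert_of_notMem, Finset.card_pair n34]
  · simp only [Finset.mem_insert, Finset.mem_singleton, not_or]; exact ⟨n23, n24⟩
  · simp only [Finset.mem_insert, Finset.mem_singleton, not_or]; exact ⟨n12, n13, n14⟩

lemma Nsol_congr {d d' : ℤ} {q : ℕ} (h : d % q = d' % q) : Nsol d q = Nsol d' q := by
  unfold Nsol
  rw [(ZMod.intCast_eq_intCast_iff' d d' q).mpr h]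

lemma Nsol_two (d : ℤ) : Nsol d 2 = 1 := by
  rcases Int.emod_two_eq_zero_or_one d with h | h
  · rw [Nsol_congr (d' := 0) (by simpa using h), Nsol_eq_card]; decide
  · rw [Nsol_congr (d' := 1) (by simpa using h), Nsol_eq_card]; decide

lemma Nsol_four {d : ℤ} (h : d % 4 = 0 ∨ d % 4 = 1) : Nsol d 4 = 2 := by
  rcases h with h | h
  · rw [Nsol_congr (d' := 0) (by simpa using h), Nsol_eq_card]; decide
  · rw [Nsol_congr (d' := 1) (by simpa using h), Nsol_eq_card]; decide

lemma Nsol_eight_five {d : ℤ} (h : d % 8 = 5) (k : ℕ) : Nsol d (2 ^ (k + 3)) = 0 := by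
  have h0 : ¬ Rt d 8 := by
    rintro ⟨y, m, hm⟩
    push_cast at hm
    have h1 : y % 8 * (y % 8) % 8 = 5 := by
      rw [← Int.mul_emod, ← sq]; omega
    have h2 : 0 ≤ y % 8 := by omega
    have h3 : y % 8 < 8 := by omega
    generalize y % 8 = r at *
    interval_cases r <;> omega
  exact Nsol_zero' (by positivity) fun hr => h0 (Rt_mono ⟨2 ^ k, by ring⟩ hr)

lemma Nsol_eight_even {d : ℤ} (h : d % 16 = 8 ∨ d % 16 = 12) : Nsol d 8 = 2 := by
  rcases h with h | h
  · rw [Nsol_congr (d' := 0) (by norm_num; omega), Nsol_eq_card]; decide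
  · rw [Nsol_congr (d' := 4) (by norm_num; omega), Nsol_eq_card]; decide

lemma Nsol_sixteen_even {d : ℤ} (h : d % 16 = 8 ∨ d % 16 = 12) (k : ℕ) : Nsol d (2 ^ (k + 4)) = 0 := by
  have h0 : ¬ Rt d 16 := by
    rintro ⟨y, m, hm⟩
    push_cast at hm
    have h1 : y % 16 * (y % 16) % 16 = 8 ∨ y % 16 * (y % 16) % 16 = 12 := by
      rw [← Int.mul_emod, ← sq]; omega
    have h2 : 0 ≤ y % 16 := by omega
    have h3 : y % 16 < 16 := by omega
    generalize y % 16 = r at *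
    interval_cases r <;> omega
  exact Nsol_zero' (by positivity) fun hr => h0 (Rt_mono ⟨2 ^ k, by ring⟩ hr)

end KD

namespace KD

open ArithmeticFunction in
noncomputable def Nf (d : ℤ) : ArithmeticFunction ℂ := ⟨fun q => if q = 0 then 0 else Nsol d q, by simp⟩

noncomputable def Ff (d : ℤ) : ArithmeticFunction ℂ := ⟨fun q => Fs d q, by simp [Fs]⟩

lemma Nf_mult (d : ℤ) : (Nf d).IsMultiplicative := by
  refine ArithmeticFunction.IsMultiplicative.iff_ne_zero.mpr ⟨by simp [Nf, Nsol_one], ?_⟩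
  intro m n hm hn h
  simp [Nf, hm, hn, Nsol_mul d m n h]

lemma Ff_zeta (d : ℤ) : Ff d * (ArithmeticFunction.zeta : ArithmeticFunction ℂ) = Nf d := by
  ext q
  rw [ArithmeticFunction.coe_mul_zeta_apply]
  rcases Nat.eq_zero_or_pos q with rfl | hq
  · simp
  · simpa [Nf, Ff, hq.ne'] using sum_Fs d q hq

lemma Ff_mult (d : ℤ) : (Ff d).IsMultiplicative := by
  have : Ff d = Nf d * (ArithmeticFunction.moebius : ArithmeticFunction ℂ) := by
    rw [← Ff_zeta, mul_assoc, ArithmeticFunction.coe_zeta_mul_coe_moebius, mul_one]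
  rw [this]
  exact (Nf_mult d).mul ArithmeticFunction.isMultiplicative_moebius.intCast

lemma Fs_one (d : ℤ) : Fs d 1 = 1 := (Ff_mult d).1

lemma Fs_mul (d : ℤ) {m n : ℕ} (h : Nat.Coprime m n) : Fs d (m * n) = Fs d m * Fs d n :=
  (Ff_mult d).2 h

lemma Fs_pp (d : ℤ) {p : ℕ} (hp : p.Prime) (k : ℕ) :
    Fs d (p ^ (k + 1)) = Nsol d (p ^ (k + 1)) - Nsol d (p ^ k) := by
  rw [← sum_Fs d _ (pow_pos hp.pos _), ← sum_Fs d _ (pow_pos hp.pos _),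
    Nat.sum_divisors_prime_pow hp, Nat.sum_divisors_prime_pow hp, Finset.sum_range_succ _ (k + 1)]
  ring

lemma Fs_four {d : ℤ} (h : d % 4 = 0 ∨ d % 4 = 1) : Fs d 4 = 1 := by
  have := Fs_pp d Nat.prime_two 1
  norm_num [Nsol_four h, Nsol_two] at this
  exact this

noncomputable def Af (d : ℤ) : ArithmeticFunction ℂ :=
  ⟨fun c => (if c % 2 = 1 then 1 else 1 / 2) * Fs d (4 * c), by simp [Fs]⟩

lemma Af_odd {d : ℤ} (h : d % 4 = 0 ∨ d % 4 = 1) {c : ℕ} (hc : c % 2 = 1) : Af d c = Fs d c := by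
  have h4 : Nat.Coprime 4 c := by
    rw [show 4 = 2 ^ 2 by norm_num]
    exact Nat.Coprime.pow_left 2 (Nat.coprime_two_left.mpr (Nat.odd_iff.mpr hc))
  simp [Af, hc, Fs_mul d h4, Fs_four h]

lemma Af_mul_odd {d : ℤ} (h : d % 4 = 0 ∨ d % 4 = 1) {m n : ℕ} (hm : m % 2 = 1) (hc : Nat.Coprime m n) :
    Af d (m * n) = Af d m * Af d n := by
  have h4 : Nat.Coprime m (4 * n) := by
    refine Nat.Coprime.mul_right ?_ hc
    rw [show 4 = 2 ^ 2 by norm_num]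
    exact Nat.Coprime.pow_right 2 (Nat.coprime_two_right.mpr (Nat.odd_iff.mpr hm))
  rw [Af_odd h hm]
  have : (m * n) % 2 = n % 2 := by rw [Nat.mul_mod, hm]; simp
  show (if (m * n) % 2 = 1 then (1 : ℂ) else 1 / 2) * Fs d (4 * (m * n)) =
    Fs d m * ((if n % 2 = 1 then 1 else 1 / 2) * Fs d (4 * n))
  rw [this, show 4 * (m * n) = m * (4 * n) by ring, Fs_mul d h4]
  ring

lemma Af_mult {d : ℤ} (h : d % 4 = 0 ∨ d % 4 = 1) : (Af d).IsMultiplicative := by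
  refine ⟨by rw [Af_odd h (by norm_num), Fs_one], ?_⟩
  intro m n hc
  rcases Nat.mod_two_eq_zero_or_one m with hm | hm
  · rcases Nat.mod_two_eq_zero_or_one n with hn | hn
    · exfalso
      have := Nat.dvd_gcd (Nat.dvd_of_mod_eq_zero hm) (Nat.dvd_of_mod_eq_zero hn)
      rw [hc] at this; omega
    · rw [mul_comm m n, Af_mul_odd h hn hc.symm, mul_comm]
  · exact Af_mul_odd h hm hc

lemma Af_two (d : ℤ) (k : ℕ) : Af d (2 ^ (k + 1)) = (Nsol d (2 ^ (k + 3)) - Nsol d (2 ^ (k + 2))) / 2 := by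
  show (if 2 ^ (k + 1) % 2 = 1 then (1 : ℂ) else 1 / 2) * Fs d (4 * 2 ^ (k + 1)) = _
  rw [show 4 * 2 ^ (k + 1) = 2 ^ (k + 2 + 1) by ring, Fs_pp d Nat.prime_two, if_neg (by rw [pow_succ]; omega)]
  ring

/-- the character -/
noncomputable def Xf (d : ℤ) : ArithmeticFunction ℂ :=
  ⟨fun n => if n = 0 then 0 else (kronecker d n : ℂ), by simp⟩

def tw (d : ℤ) : ℤ := if d % 2 = 0 then 0 else if d % 8 = 1 ∨ d % 8 = 7 then 1 else -1

lemma kron_nat (d : ℤ) {n : ℕ} (hn : n ≠ 0) :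
    kronecker d n = tw d ^ (n.factorization 2) * jacobiSym d (n / 2 ^ (n.factorization 2)) := by
  unfold kronecker tw
  have h1 : ¬ ((n : ℤ) < 0 ∧ d < 0) := by omega
  simp only [Int.natAbs_natCast, Int.natCast_eq_zero, hn, if_false, h1, one_mul]
  congr 1
  split_ifs with h <;> simp_all

lemma kron_mul (d : ℤ) {m n : ℕ} (hm : m ≠ 0) (hn : n ≠ 0) :
    kronecker d ((m * n : ℕ)) = kronecker d m * kronecker d n := by
  have : NeZero (m / 2 ^ m.factorization 2) := ⟨(Nat.ordCompl_pos 2 hm).ne'⟩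
  have : NeZero (n / 2 ^ n.factorization 2) := ⟨(Nat.ordCompl_pos 2 hn).ne'⟩
  rw [kron_nat d hm, kron_nat d hn, kron_nat d (mul_ne_zero hm hn), Nat.ordCompl_mul,
    jacobiSym.mul_right, Nat.factorization_mul hm hn, Finsupp.add_apply, pow_add]
  ring

lemma kron_one (d : ℤ) : kronecker d (1 : ℕ) = 1 := by
  rw [kron_nat d one_ne_zero]; simp

lemma kron_pow (d : ℤ) {p : ℕ} (hp : p ≠ 0) (k : ℕ) : kronecker d ((p ^ k : ℕ)) = kronecker d p ^ k := by
  induction k with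
  | zero => rw [pow_zero, kron_one, pow_zero]
  | succ k ih => rw [pow_succ, kron_mul d (pow_ne_zero _ hp) hp, ih, pow_succ]

lemma kron_odd (d : ℤ) {p : ℕ} (hp : p.Prime) (hp2 : p ≠ 2) : kronecker d p = jacobiSym d p := by
  have : p.factorization 2 = 0 := by
    apply Nat.factorization_eq_zero_of_not_dvd
    intro h
    exact hp2 ((Nat.prime_dvd_prime_iff_eq Nat.prime_two hp).mp h).symm
  rw [kron_nat d hp.ne_zero, this]; simp

lemma kron_two (d : ℤ) : kronecker d (2 : ℕ) = tw d := by
  rw [kron_nat d two_ne_zero]; simp [Nat.Prime.factorization_self Nat.prime_two]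

lemma abs_kron (d : ℤ) {n : ℕ} (hn : n ≠ 0) : |kronecker d n| ≤ 1 := by
  rw [kron_nat d hn, abs_mul, abs_pow]
  have h1 : |tw d| ≤ 1 := by unfold tw; split_ifs <;> simp
  have h2 : |jacobiSym d (n / 2 ^ n.factorization 2)| ≤ 1 := by
    rcases jacobiSym.trichotomy d (n / 2 ^ n.factorization 2) with h | h | h <;> simp [h]
  exact mul_le_one₀ (pow_le_one₀ (abs_nonneg _) h1) (abs_nonneg _) h2

lemma Xf_mult (d : ℤ) : (Xf d).IsMultiplicative := by
  refine ArithmeticFunction.IsMultiplicative.iff_ne_zero.mpr ⟨?_, ?_⟩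
  · show (if 1 = 0 then (0:ℂ) else (kronecker d (1 : ℕ) : ℂ)) = 1
    rw [kron_one]; simp
  intro m n hm hn h
  show (if m * n = 0 then (0:ℂ) else (kronecker d ((m * n : ℕ)) : ℂ)) = 
    (if m = 0 then (0:ℂ) else (kronecker d m : ℂ)) * (if n = 0 then (0:ℂ) else (kronecker d n : ℂ))
  rw [if_neg hm, if_neg hn, if_neg (mul_ne_zero hm hn), kron_mul d hm hn]
  push_cast; rfl

lemma Xf_pow (d : ℤ) {p : ℕ} (hp : p ≠ 0) (k : ℕ) : Xf d (p ^ k) = (kronecker d p : ℂ) ^ k := by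
  show (if p ^ k = 0 then (0:ℂ) else (kronecker d ((p ^ k : ℕ)) : ℂ)) = _
  rw [if_neg (pow_ne_zero _ hp), kron_pow d hp]
  push_cast; rfl

lemma fund_mod {d : ℤ} (hd : IsFundamentalDiscriminant d) : d % 4 = 1 ∨ d % 16 = 8 ∨ d % 16 = 12 := by
  rcases hd with h | h <;> omega

lemma fund_sq {d : ℤ} (hd : IsFundamentalDiscriminant d) {p : ℕ} (hp : p.Prime) (hp2 : p ≠ 2) :
    ¬ (p : ℤ) ^ 2 ∣ d := by
  have hpi : Prime (p : ℤ) := Nat.prime_iff_prime_int.mp hp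
  intro h
  rcases hd with ⟨_, h1⟩ | ⟨h0, h1, _⟩
  · exact hpi.not_isUnit (h1 p (by rwa [← sq]))
  · apply hpi.not_isUnit (h1 p ?_)
    rw [← sq]
    have h4 : d = 2 ^ 2 * (d / 4) := by omega
    rw [h4] at h
    refine IsCoprime.dvd_of_dvd_mul_left (IsCoprime.pow ?_) h
    apply (Nat.isCoprime_iff_coprime (m := p) (n := 2)).mpr
    exact (Nat.coprime_primes hp Nat.prime_two).mpr hp2

lemma Af_cases {d : ℤ} (hd : IsFundamentalDiscriminant d) {p : ℕ} (hp : p.Prime) :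
    Af d p = kronecker d p ∧
    ((kronecker d p ^ 2 = 1 ∧ ∀ k, Af d (p ^ (k + 2)) = 0) ∨
      (kronecker d p = 0 ∧ Af d (p ^ 2) = -1 ∧ ∀ k, Af d (p ^ (k + 3)) = 0)) := by
  have hm := fund_mod hd
  by_cases hp2 : p = 2
  · subst hp2
    rw [kron_two]
    have e1 := Af_two d 0
    have e2 := Af_two d 1
    have h4 : Nsol d 4 = 2 := Nsol_four (by omega)
    norm_num [h4] at e1 e2
    by_cases h1 : d % 4 = 1
    · by_cases h8 : d % 8 = 1
      · have t : tw d = 1 := by unfold tw; rw [if_neg (by omega), if_pos (by omega)]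
        have c0 := count_two h8 0
        norm_num at c0
        rw [t]
        refine ⟨by rw [e1, c0]; norm_num, Or.inl ⟨by norm_num, fun k => ?_⟩⟩
        rw [Af_two d (k + 1), count_two h8 (k + 1), count_two h8 k]; simp
      · have h5 : d % 8 = 5 := by omega
        have t : tw d = -1 := by unfold tw; rw [if_neg (by omega), if_neg (by omega)]
        have c0 := Nsol_eight_five h5 0
        norm_num at c0
        rw [t]
        refine ⟨by rw [e1, c0]; norm_num, Or.inl ⟨by norm_num, fun k => ?_⟩⟩
        rw [Af_two d (k + 1), Nsol_eight_five h5 (k + 1), Nsol_eight_five h5 k]; simp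
    · have hm' : d % 16 = 8 ∨ d % 16 = 12 := by omega
      have t : tw d = 0 := by unfold tw; rw [if_pos (by omega)]
      have c0 := Nsol_eight_even hm'
      have c1 := Nsol_sixteen_even hm' 0
      norm_num at c1
      rw [t]
      refine ⟨by rw [e1, c0]; norm_num, Or.inr ⟨rfl, by norm_num; rw [e2, c0, c1]; norm_num, fun k => ?_⟩⟩
      rw [Af_two d (k + 2), Nsol_sixteen_even hm' (k + 1), Nsol_sixteen_even hm' k]; simp
  · have h4 : d % 4 = 0 ∨ d % 4 = 1 := by omega
    have hpo : Odd p := hp.odd_of_ne_two hp2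
    have hA : ∀ k, Af d (p ^ k) = Fs d (p ^ k) := fun k => Af_odd h4 (Nat.odd_iff.mp (hpo.pow))
    rw [kron_odd d hp hp2]
    have hN := Nsol_prime hp hp2 d
    have hNc : (Nsol d p : ℂ) = jacobiSym d p + 1 := by exact_mod_cast hN
    refine ⟨?_, ?_⟩
    · have := hA 1
      rw [Fs_pp d hp 0] at this
      simp only [pow_one, pow_zero, zero_add, Nsol_one, hNc] at this
      rw [this]; push_cast; ring
    by_cases hpd : (p : ℤ) ∣ d
    · right
      have hz : jacobiSym d p = 0 := by
        have : Fact p.Prime := ⟨hp⟩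
        rw [← jacobiSym.legendreSym.to_jacobiSym, legendreSym.eq_zero_iff]
        rwa [ZMod.intCast_zmod_eq_zero_iff_dvd]
      have hs := Nsol_sq hp hpd (fund_sq hd hp hp2)
      refine ⟨hz, ?_, fun k => ?_⟩
      · rw [hA, Fs_pp d hp 1, hs 0, pow_one, hNc, hz]; simp
      · rw [hA, Fs_pp d hp, hs k, hs (k + 1)]; simp
    · left
      refine ⟨?_, fun k => ?_⟩
      · apply jacobiSym.sq_one
        rw [Int.gcd_comm, ← Int.isCoprime_iff_gcd_eq_one]
        exact (Nat.prime_iff_prime_int.mp hp).coprime_iff_not_dvd.mpr hpd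
      · rw [hA, Fs_pp d hp, Nsol_odd_const hp hp2 hpd, Nsol_odd_const hp hp2 hpd, sub_self]

end KD

namespace KD

open Classical in
noncomputable def Sq : ArithmeticFunction ℂ :=
  ⟨fun n => if n ≠ 0 ∧ IsSquare n then 1 else 0, by simp⟩

open Classical in
lemma Sq_apply (n : ℕ) : Sq n = if n ≠ 0 ∧ IsSquare n then 1 else 0 := rfl

lemma isSquare_left {m n : ℕ} (h : Nat.Coprime m n) (hs : IsSquare (m * n)) : IsSquare m := by
  obtain ⟨r, hr⟩ := hs
  rw [← sq] at hr
  have hu : IsUnit (gcd m n) := by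
    show IsUnit (Nat.gcd m n)
    rw [h]; exact isUnit_one
  obtain ⟨t, ht⟩ := exists_eq_pow_of_mul_eq_pow hu hr
  exact ⟨t, by rw [ht, sq]⟩

lemma Sq_mult : Sq.IsMultiplicative := by
  refine ArithmeticFunction.IsMultiplicative.iff_ne_zero.mpr ⟨by simp [Sq_apply], ?_⟩
  intro m n hm hn h
  have : IsSquare (m * n) ↔ IsSquare m ∧ IsSquare n :=
    ⟨fun hs => ⟨isSquare_left h hs, isSquare_left h.symm (by rwa [mul_comm])⟩, fun hs => hs.1.mul hs.2⟩
  by_cases h1 : IsSquare m <;> by_cases h2 : IsSquare n <;> simp [Sq_apply, hm, hn, this, h1, h2]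

lemma Sq_pow {p : ℕ} (hp : p.Prime) (k : ℕ) : Sq (p ^ k) = if Even k then 1 else 0 := by
  have : IsSquare (p ^ k) ↔ Even k := by
    constructor
    · rintro ⟨r, hr⟩
      have h := congrArg (fun n => n.factorization p) hr
      have hr0 : r ≠ 0 := by
        rintro rfl
        exact (pow_ne_zero k hp.ne_zero) (by simpa using hr)
      simp only [Nat.factorization_mul hr0 hr0, Nat.Prime.factorization_pow hp, Finsupp.single_eq_same,
        Finsupp.add_apply] at h
      exact ⟨_, h⟩
    · exact fun h => h.isSquare_pow p
  simp [Sq_apply, this, hp.ne_zero]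

lemma A_Sq {d : ℤ} (hd : IsFundamentalDiscriminant d) : Af d * Sq = Xf d := by
  have h4 : d % 4 = 0 ∨ d % 4 = 1 := by have := fund_mod hd; omega
  have hA := Af_mult h4
  refine (ArithmeticFunction.IsMultiplicative.eq_iff_eq_on_prime_powers _ (hA.mul Sq_mult) _ (Xf_mult d)).mpr ?_
  intro p k hp
  rw [Xf_pow d hp.ne_zero, ArithmeticFunction.mul_apply,
    Nat.sum_divisorsAntidiagonal (fun x y => Af d x * Sq y), Nat.sum_divisors_prime_pow hp]
  have h1 : ∀ i ∈ Finset.range (k + 1), Af d (p ^ i) * Sq (p ^ k / p ^ i) =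
      Af d (p ^ i) * (if Even (k - i) then 1 else 0) := by
    intro i hi
    rw [Nat.pow_div (by simpa [Nat.lt_succ_iff] using hi) hp.pos, Sq_pow hp]
  rw [Finset.sum_congr rfl h1]
  obtain ⟨a1, hc⟩ := Af_cases hd hp
  match k with
  | 0 => simp [hA.1]
  | 1 => simp [Finset.sum_range_succ, a1]
  | k + 2 =>
    rw [Finset.sum_range_succ', Finset.sum_range_succ', Finset.sum_range_succ']
    have hz : ∑ i ∈ Finset.range k, Af d (p ^ (i + 1 + 1 + 1)) * (if Even (k + 2 - (i + 1 + 1 + 1)) then (1:ℂ) else 0) = 0 := by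
      apply Finset.sum_eq_zero
      intro i _
      rcases hc with ⟨_, h⟩ | ⟨_, _, h⟩
      · rw [show i + 1 + 1 + 1 = (i + 1) + 2 by ring, h, zero_mul]
      · rw [show i + 1 + 1 + 1 = i + 3 by ring, h, zero_mul]
    rw [hz]
    have e1 : k + 2 - (0 + 1 + 1) = k := by omega
    have e2 : k + 2 - (0 + 1) = k + 1 := by omega
    rw [e1, e2, Nat.sub_zero, pow_zero, hA.1, zero_add, zero_add, pow_one, a1]
    simp only [Nat.even_add_one]
    simp only [show ((1:ℕ) + 1) = 2 from rfl, not_not]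
    rcases hc with ⟨h2, h⟩ | ⟨h0, h2, _⟩
    · rw [h 0]
      have h2' : (kronecker d p : ℂ) ^ 2 = 1 := by exact_mod_cast h2
      rcases Nat.even_or_odd k with he | ho
      · obtain ⟨j, rfl⟩ := he
        rw [show j + j + 2 = 2 * (j + 1) by ring, pow_mul, h2']
        simp
      · have : ¬ Even k := Nat.not_even_iff_odd.mpr ho
        obtain ⟨j, rfl⟩ := ho
        rw [show 2 * j + 1 + 2 = 2 * (j + 1) + 1 by ring, pow_succ, pow_mul, h2']
        simp [this]
    · rw [h2, h0]; by_cases he : Even k <;> simp [he]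

lemma norm_Af {d : ℤ} (hd : IsFundamentalDiscriminant d) (n : ℕ) : ‖Af d n‖ ≤ 1 := by
  have h4 : d % 4 = 0 ∨ d % 4 = 1 := by have := fund_mod hd; omega
  have hA := Af_mult h4
  induction n using Nat.recOnPosPrimePosCoprime with
  | zero => simp
  | one => simp [hA.1]
  | prime_pow p k hp hk =>
    obtain ⟨a1, hc⟩ := Af_cases hd hp
    match k, hk with
    | 1, _ =>
      rw [pow_one, a1]
      have := abs_kron d hp.ne_zero
      rw [Complex.norm_intCast]
      exact_mod_cast this
    | 2, _ =>
      rcases hc with ⟨_, h⟩ | ⟨_, h, _⟩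
      · rw [h 0]; simp
      · rw [h]; simp
    | k + 3, _ =>
      rcases hc with ⟨_, h⟩ | ⟨_, _, h⟩
      · rw [show k + 3 = (k + 1) + 2 by ring, h]; simp
      · rw [h]; simp
  | coprime a b _ _ hab ha hb =>
    rw [hA.2 hab, norm_mul]
    exact mul_le_one₀ ha (norm_nonneg _) hb

lemma LS_succ (f : ℕ → ℂ) (s : ℂ) : LSeries f s = ∑' n : ℕ, f (n + 1) / ((n : ℂ) + 1) ^ s := by
  have h : ∑' n : ℕ, LSeries.term f s (Nat.succ n) = ∑' n, LSeries.term f s n := by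
    refine Function.Injective.tsum_eq Nat.succ_injective ?_
    intro n hn
    rcases n with _ | n
    · simp at hn
    · exact ⟨n, rfl⟩
  rw [LSeries, ← h]
  refine tsum_congr fun n => ?_
  rw [LSeries.term_def, if_neg (Nat.succ_ne_zero n)]
  push_cast; rfl

lemma LS_Sq {s : ℂ} (hs : 1 < s.re) : LSeries (fun n => Sq n) s = riemannZeta (2 * s) := by
  have hs2 : 1 < (2 * s).re := by simp; linarith
  rw [zeta_eq_tsum_one_div_nat_add_one_cpow hs2, LSeries]
  have hinj : Function.Injective (fun n : ℕ => (n + 1) ^ 2) := by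
    intro a b h
    have := Nat.pow_left_injective two_ne_zero h
    omega
  rw [← Function.Injective.tsum_eq hinj]
  · refine tsum_congr fun n => ?_
    have h0 : (n + 1) ^ 2 ≠ 0 := by positivity
    rw [LSeries.term_def, if_neg h0, Sq_apply, if_pos ⟨h0, ⟨n + 1, sq _⟩⟩]
    congr 1
    have := Complex.natCast_mul_natCast_cpow (n + 1) (n + 1) s
    rw [sq, Nat.cast_mul, this, two_mul, Complex.cpow_add]
    · push_cast; rfl
    · exact_mod_cast Nat.succ_ne_zero n
  · intro n hn
    rw [Function.mem_support, LSeries.term_def] at hn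
    by_cases h : n ≠ 0 ∧ IsSquare n
    · obtain ⟨h0, r, rfl⟩ := h
      rcases r with _ | r
      · simp at h0
      · exact ⟨r, sq _⟩
    · simp [Sq_apply, h] at hn

lemma Kplus_Af (d : ℤ) {c : ℕ} (hc : 0 < c) : Kplus d 0 (4 * c) = 4 * (Real.sqrt c : ℂ) * Af d c := by
  have h := Kplus_eq d c hc
  have hs : (Real.sqrt c : ℂ) ≠ 0 := by
    have : (0:ℝ) < c := by exact_mod_cast hc
    exact_mod_cast (Real.sqrt_pos.mpr this).ne'
  have hss : (Real.sqrt c : ℂ) * (Real.sqrt c : ℂ) = c := by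
    rw [← Complex.ofReal_mul, Real.mul_self_sqrt (Nat.cast_nonneg c)]; simp
  have hA : Af d c = (if c % 2 = 1 then 1 else 1 / 2) * Fs d (4 * c) := rfl
  apply mul_left_cancel₀ (mul_ne_zero (two_ne_zero (α := ℂ)) hs)
  rw [h, hA]
  split_ifs
  · linear_combination -8 * Fs d (4 * c) * hss
  · linear_combination -4 * Fs d (4 * c) * hss

theorem main (d : ℤ) (hd : IsFundamentalDiscriminant d) (s : ℂ) (hs : 1 < s.re) :
    ∑' c : ℕ, Kplus d 0 (4 * (c + 1)) * ((c : ℂ) + 1) ^ (-s - 1/2) =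
      4 * (∑' n : ℕ, (kronecker d (n + 1) : ℂ) / ((n : ℂ) + 1) ^ s) /
        riemannZeta (2 * s) := by
  have hs2 : 1 < (2 * s).re := by simp; linarith
  have hz : riemannZeta (2 * s) ≠ 0 := riemannZeta_ne_zero_of_one_lt_re hs2
  have s1 : LSeriesSummable (fun n => Af d n) s :=
    LSeriesSummable_of_bounded_of_one_lt_re (m := 1) (fun n _ => norm_Af hd n) hs
  have s2 : LSeriesSummable (fun n => Sq n) s :=
    LSeriesSummable_of_bounded_of_one_lt_re (m := 1)
      (fun n _ => by rw [Sq_apply]; split_ifs <;> simp) hs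
  have hm := ArithmeticFunction.LSeries_mul' s1 s2
  rw [A_Sq hd, LS_Sq hs, LS_succ, LS_succ] at hm
  have e1 : ∑' n : ℕ, Xf d (n + 1) / ((n : ℂ) + 1) ^ s = ∑' n : ℕ, (kronecker d (n + 1) : ℂ) / ((n : ℂ) + 1) ^ s := by
    refine tsum_congr fun n => ?_
    have : Xf d (n + 1) = (kronecker d ((n + 1 : ℕ)) : ℂ) :=
      if_neg (t := (0 : ℂ)) (Nat.succ_ne_zero n)
    rw [this]; push_cast; rfl
  rw [← e1, hm, eq_div_iff hz, ← mul_assoc]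
  congr 1
  rw [← tsum_mul_left]
  refine tsum_congr fun c => ?_
  have hc0 : (c : ℂ) + 1 ≠ 0 := by exact_mod_cast Nat.succ_ne_zero c
  rw [Kplus_Af d (Nat.succ_pos c), sub_eq_add_neg, Complex.cpow_add _ _ hc0, Complex.cpow_neg, Complex.cpow_neg]
  have hq : ((c : ℂ) + 1) ^ (1 / 2 : ℂ) = (Real.sqrt ((c + 1 : ℕ) : ℝ) : ℂ) := by
    rw [Real.sqrt_eq_rpow, Complex.ofReal_cpow (Nat.cast_nonneg _)]
    push_cast; rfl
  have hq0 : ((c : ℂ) + 1) ^ (1 / 2 : ℂ) ≠ 0 := by simp [Complex.cpow_eq_zero_iff, hc0]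
  rw [hq] at hq0 ⊢
  field_simp

end KD

/-- For `Re(s) > 1` and a positive fundamental discriminant `d`,
`Σ_{c ≥ 1} K⁺(d,0;4c) c^{-s-1/2} = 4 L(s,χ_d)/ζ(2s)`. -/
theorem kloosterman_dirichlet_series
    (d : ℤ) (hd : IsFundamentalDiscriminant d) (hd0 : 0 < d)
    (s : ℂ) (hs : 1 < s.re) :
    ∑' c : ℕ, Kplus d 0 (4 * (c + 1)) * ((c : ℂ) + 1) ^ (-s - 1/2) =
      4 * (∑' n : ℕ, (kronecker d (n + 1) : ℂ) / ((n : ℂ) + 1) ^ s) /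
        riemannZeta (2 * s) := by
  exact KD.main d hd s hs
end
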